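/- Let 1 ≤ r ≤ n, let p = (p_1,…,p_n) be a size vector with p_i ≥ 3 for all i, and let p_1 = min_i p_i. If (A, B) is a maximal pair of r-cross-intersecting families in S_p, then the number of coordinates relevant for A or for B is at most r·log(p_1) / ((1 − 2/p_1)·log(p_1 − 1)). Consequently, if in addition r·log(p_1) < (r + 4)·(1 − 2/p_1)·log(p_1 − 1), then A and B are balls (in at most r + 3 coordinates). -/

import Mathlib

open Finset

/-- Families `A`, `B` of vectors in `S_p` (modelled as `∀ i, Fin (p i)`) are
`r`-cross-intersecting: every `x ∈ A` and `y ∈ B` agree in at least `r`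
coordinates. -/
def CrossInt {n : ℕ} {p : Fin n → ℕ} (r : ℕ)
    (A B : Finset (∀ i, Fin (p i))) : Prop :=
  ∀ x ∈ A, ∀ y ∈ B, r ≤ (univ.filter (fun i => x i = y i)).card

/-- `(A, B)` is a maximal `r`-cross-intersecting pair. -/
def MaxPair {n : ℕ} {p : Fin n → ℕ} (r : ℕ)
    (A B : Finset (∀ i, Fin (p i))) : Prop :=
  CrossInt r A B ∧ ∀ A' B' : Finset (∀ i, Fin (p i)),
    CrossInt r A' B' → A'.card * B'.card ≤ A.card * B.card

/-- Coordinate `i` is relevant for `A`: some two vectors differing only in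
coordinate `i` are such that one belongs to `A` and the other one does not. -/
def Relevant {n : ℕ} {p : Fin n → ℕ} (A : Finset (∀ i, Fin (p i)))
    (i : Fin n) : Prop :=
  ∃ x y : ∀ j, Fin (p j), (∀ j, j ≠ i → x j = y j) ∧ x ∈ A ∧ y ∉ A

/-- The Hamming ball of radius `k` around `x₀` in the coordinates `T`. -/
def hBall {n : ℕ} {p : Fin n → ℕ} (T : Finset (Fin n))
    (x₀ : ∀ i, Fin (p i)) (k : ℕ) : Finset (∀ i, Fin (p i)) :=
  univ.filter (fun x => (T.filter (fun i => x i ≠ x₀ i)).card ≤ k)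

set_option linter.unusedSectionVars false



section core
variable {ι : Type*} [DecidableEq ι]

/-- weight of a set family -/
def wt (q : ι → ℕ) (F : Finset (Finset ι)) : ℕ := ∑ U ∈ F, ∏ i ∈ U, q i

/-- heavy condition -/
def Heavy (T : Finset ι) (q : ι → ℕ) (F : Finset (Finset ι)) : Prop :=
  ∀ i ∈ T, (1 + q i) * wt q (F.filter (fun U => i ∈ U)) ≤ wt q F

/-- `F` consists of all subsets of `T` compatible with `G`. -/
def Clo (T : Finset ι) (s : ℕ) (F G : Finset (Finset ι)) : Prop :=
  ∀ U, U ∈ F ↔ U ⊆ T ∧ ∀ V ∈ G, (U ∪ V).card ≤ s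

/-- ball of sets -/
def sBall (T : Finset ι) (a : ℕ) : Finset (Finset ι) := T.powerset.filter (fun U => U.card ≤ a)

lemma heavy_sum {T : Finset ι} {q : ι → ℕ} {F : Finset (Finset ι)} (h : Heavy T q F)
    {W : Finset ι} (hW : W ⊆ T) :
    ∑ U ∈ F, ((∏ i ∈ U, q i : ℕ) : ℤ) * (∑ i ∈ U ∩ W, (1 + (q i : ℤ)) - W.card) ≤ 0 := by
  have h1 : ∑ i ∈ W, (1 + q i) * wt q (F.filter (fun U => i ∈ U)) ≤ W.card * wt q F := by
    calc _ ≤ ∑ i ∈ W, wt q F := sum_le_sum fun i hi => h i (hW hi)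
      _ = _ := by simp
  have h2 : ∑ i ∈ W, (1 + q i) * wt q (F.filter (fun U => i ∈ U)) =
      ∑ U ∈ F, (∏ i ∈ U, q i) * ∑ i ∈ U ∩ W, (1 + q i) := by
    simp only [wt, sum_filter, mul_sum]
    rw [sum_comm]
    refine sum_congr rfl fun U _ => ?_
    rw [inter_comm, ← filter_mem_eq_inter, sum_filter]
    refine sum_congr rfl fun i _ => ?_
    split_ifs <;> ring
  rw [h2] at h1
  have h3 : ((∑ U ∈ F, (∏ i ∈ U, q i) * ∑ i ∈ U ∩ W, (1 + q i) : ℕ) : ℤ) ≤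
    ((W.card * wt q F : ℕ) : ℤ) := by exact_mod_cast h1
  simp only [mul_sub, sum_sub_distrib, ← sum_mul]
  push_cast [wt] at h3 ⊢
  linarith

lemma Clo.empty_mem {T : Finset ι} {s : ℕ} {F G : Finset (Finset ι)} (h : Clo T s F G)
    (hF : F.Nonempty) : ∅ ∈ F := by
  obtain ⟨U, hU⟩ := hF
  rw [h] at hU ⊢
  refine ⟨by simp, fun V hV => le_trans (card_le_card ?_) (hU.2 V hV)⟩
  simp

lemma Clo.down {T : Finset ι} {s : ℕ} {F G : Finset (Finset ι)} (h : Clo T s F G)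
    {U U' : Finset ι} (hU : U ∈ F) (hs : U' ⊆ U) : U' ∈ F := by
  rw [h] at hU ⊢
  refine ⟨hs.trans hU.1, fun V hV => le_trans (card_le_card ?_) (hU.2 V hV)⟩
  exact union_subset_union_left hs

lemma e2_identity (q : ι → ℕ) (T : Finset ι) :
    2 * ∑ U ∈ T.powersetCard 2, ∏ i ∈ U, q i + ∑ i ∈ T, q i ^ 2 = (∑ i ∈ T, q i) ^ 2 := by
  induction T using Finset.induction_on with
  | empty => simp
  | insert a T ha ih =>
    rw [powersetCard_succ_insert ha, sum_union, sum_image, powersetCard_one, sum_map,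
      sum_insert ha, sum_insert ha]
    · have : ∑ x ∈ T, ∏ i ∈ insert a ((⟨singleton, singleton_injective⟩ : ι ↪ Finset ι) x), q i
          = q a * ∑ x ∈ T, q x := by
        rw [mul_sum]
        refine sum_congr rfl fun x hx => ?_
        have : a ≠ x := fun h => ha (h ▸ hx)
        simp [prod_insert, this]
      rw [this]
      nlinarith
    · intro U hU V hV hUV
      have hU' : a ∉ U := fun h => ha ((mem_powersetCard.1 hU).1 h)
      have hV' : a ∉ V := fun h => ha ((mem_powersetCard.1 hV).1 h)
      rw [← erase_insert hU', ← erase_insert hV']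
      rw [hUV]
    · rw [disjoint_left]
      intro U hU hU2
      obtain ⟨V, hV, rfl⟩ := mem_image.1 hU2
      exact ha ((mem_powersetCard.1 hU).1 (mem_insert_self _ _))

lemma prod_ge_of_card {q : ι → ℕ} {U : Finset ι} (hq : ∀ i ∈ U, 2 ≤ q i) :
    2 ^ U.card ≤ ∏ i ∈ U, q i := by
  rw [← prod_const]
  exact prod_le_prod' hq

lemma sum_ge_of_card {q : ι → ℕ} {U : Finset ι} (hq : ∀ i ∈ U, 2 ≤ q i) :
    2 * U.card ≤ ∑ i ∈ U, q i := by
  rw [mul_comm]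
  simpa using card_nsmul_le_sum U q 2 hq

lemma e2_ge {q : ι → ℕ} {U : Finset ι} (hq : ∀ i ∈ U, 2 ≤ q i) (hc : 4 ≤ U.card) :
    24 ≤ ∑ V ∈ U.powersetCard 2, ∏ i ∈ V, q i := by
  have h := card_nsmul_le_sum (U.powersetCard 2) (fun V => ∏ i ∈ V, q i) 4 (by
    intro V hV
    rw [mem_powersetCard] at hV
    have := prod_ge_of_card (q := q) (U := V) (fun i hi => hq i (hV.1 hi))
    rw [hV.2] at this
    simpa using this)
  rw [card_powersetCard, smul_eq_mul] at h
  have h2 : Nat.choose 4 2 ≤ Nat.choose U.card 2 := Nat.choose_le_choose 2 hc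
  have h3 : Nat.choose 4 2 = 6 := by decide
  omega

/-- sums over families containing everything of size at most one -/
lemma sum_split {T : Finset ι} {F : Finset (Finset ι)} (hT : ∀ U ∈ F, U ⊆ T)
    (h2 : ∀ U ∈ F, U.card ≤ 2) (h0 : ∅ ∈ F) (h1 : ∀ i ∈ T, {i} ∈ F) {M : Type*}
    [AddCommMonoid M] (φ : Finset ι → M) :
    ∑ U ∈ F, φ U = φ ∅ + (∑ i ∈ T, φ {i} + ∑ U ∈ F.filter (fun U => U.card = 2), φ U) := by
  have hF : F = {∅} ∪ (T.image singleton ∪ F.filter (fun U => U.card = 2)) := by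
    ext U
    simp only [mem_union, mem_singleton, mem_image, mem_filter]
    constructor
    · intro hU
      have := h2 U hU
      interval_cases h : U.card
      · left; simpa using h
      · right; left
        obtain ⟨a, rfl⟩ := card_eq_one.1 h
        exact ⟨a, hT _ hU (mem_singleton_self a), rfl⟩
      · right; right; exact ⟨hU, rfl⟩
    · rintro (rfl | ⟨a, ha, rfl⟩ | h)
      · exact h0
      · exact h1 a ha
      · exact h.1
  conv_lhs => rw [hF]
  rw [sum_union, sum_union, sum_singleton, sum_image]
  · intro a _ b _ h
    simpa using h
  · rw [disjoint_left]
    intro U hU hU2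
    obtain ⟨a, _, rfl⟩ := mem_image.1 hU
    simp at hU2
  · rw [disjoint_left]
    intro U hU hU2
    rw [mem_singleton] at hU
    subst hU
    simp at hU2

lemma sBall_split (T : Finset ι) (q : ι → ℕ) :
    wt q (sBall T 1) = 1 + ∑ i ∈ T, q i ∧
    wt q (sBall T 2) = 1 + ∑ i ∈ T, q i + ∑ U ∈ T.powersetCard 2, ∏ i ∈ U, q i := by
  constructor
  · unfold wt
    rw [sum_split (T := T)]
    · have : (sBall T 1).filter (fun U => U.card = 2) = ∅ := by
        ext U; simp [sBall]; intros; omega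
      simp [this]
    all_goals simp +contextual [sBall]
    intros; omega
  · unfold wt
    rw [sum_split (T := T)]
    · have : (sBall T 2).filter (fun U => U.card = 2) = T.powersetCard 2 := by
        ext U; simp [sBall, mem_powersetCard]; intros; omega
      simp [this, add_assoc]
    all_goals simp +contextual [sBall]
end core


section core2
variable {ι : Type*} [DecidableEq ι]

/-- A family on at most three points satisfying the heavy condition is trivial, or consists of
the three singletons with all weights two. -/
lemma small_support {T : Finset ι} {q : ι → ℕ} (hq : ∀ i ∈ T, 2 ≤ q i) {s : ℕ}
    {F G : Finset (Finset ι)} (hG : Clo T s G F) (h0 : ∅ ∈ G) (hv : Heavy T q G)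
    {X : Finset ι} (hX : X.card ≤ 3) (hGX : ∀ V ∈ G, V ⊆ X) :
    G = {∅} ∨ ∃ M ⊆ T, M.card = 3 ∧ (∀ i ∈ M, q i = 2) ∧ (∀ i ∈ M, {i} ∈ G) ∧
      wt q G = 7 := by
  set M := X.filter (fun i => {i} ∈ G) with hM
  have hMT : M ⊆ T := by
    intro i hi
    have := ((hG _).1 (mem_filter.1 hi).2).1
    exact this (mem_singleton_self i)
  have hMc : M.card ≤ 3 := (card_filter_le _ _).trans hX
  have hGM : ∀ V ∈ G, V ⊆ M := by
    intro V hV i hi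
    exact mem_filter.2 ⟨hGX V hV hi, hG.down hV (by simpa using hi)⟩
  have hMs : ∀ i ∈ M, {i} ∈ G := fun i hi => (mem_filter.1 hi).2
  clear_value M
  have key := heavy_sum hv hMT
  set φ : Finset ι → ℤ := fun U => ((∏ i ∈ U, q i : ℕ) : ℤ) * (∑ i ∈ U ∩ M, (1 + (q i : ℤ)) - M.card)
    with hφ
  have hMc' : (M.card : ℤ) ≤ 3 := by exact_mod_cast hMc
  have hφ0 : φ ∅ = - M.card := by simp [hφ]
  have hφ1 : ∀ i ∈ M, φ {i} = q i * (1 + q i - M.card) := by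
    intro i hi
    simp [hφ, singleton_inter_of_mem hi]
  have hφ2 : ∀ U ∈ G, 2 ≤ U.card → 12 ≤ φ U := by
    intro U hU hc
    have hUM := hGM U hU
    have hw := prod_ge_of_card (q := q) (U := U) (fun i hi => hq i (hMT (hUM hi)))
    have hw4 : 4 ≤ ∏ i ∈ U, q i := le_trans (by
      calc 4 = 2 ^ 2 := by norm_num
        _ ≤ 2 ^ U.card := Nat.pow_le_pow_right (by norm_num) hc) hw
    have hs := sum_ge_of_card (q := q) (U := U) (fun i hi => hq i (hMT (hUM hi)))
    have hw4' : (4 : ℤ) ≤ ((∏ i ∈ U, q i : ℕ) : ℤ) := by exact_mod_cast hw4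
    have hs' : 2 * (U.card : ℤ) ≤ ∑ i ∈ U, (q i : ℤ) := by exact_mod_cast hs
    simp only [hφ, inter_eq_left.2 hUM, sum_add_distrib]
    simp only [sum_const, nsmul_eq_mul, mul_one]
    have hc' : (2 : ℤ) ≤ U.card := by exact_mod_cast hc
    nlinarith
  have hφ1' : ∀ i ∈ M, 0 ≤ φ {i} := by
    intro i hi
    rw [hφ1 i hi]
    have := hq i (hMT hi)
    have : (2 : ℤ) ≤ q i := by exact_mod_cast this
    apply mul_nonneg <;> linarith
  have hφn : ∀ U ∈ G, U ≠ ∅ → 0 ≤ φ U := by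
    intro U hU hne
    have : 0 < U.card := card_pos.2 (nonempty_iff_ne_empty.2 hne)
    by_cases h : U.card = 1
    · obtain ⟨i, rfl⟩ := card_eq_one.1 h
      exact hφ1' i (hGM _ hU (mem_singleton_self i))
    · have := hφ2 U hU (by omega)
      linarith
  -- no large sets
  have hle1 : ∀ U ∈ G, U.card ≤ 1 := by
    intro U hU
    by_contra hc
    have hne : U ≠ ∅ := by rintro rfl; simp at hc
    have hsub : ({∅, U} : Finset (Finset ι)) ⊆ G := by
      intro V hV
      simp only [mem_insert, mem_singleton] at hV
      rcases hV with rfl | rfl <;> assumption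
    have := sum_le_sum_of_subset_of_nonneg (f := φ) hsub (by
      intro V hV hV2
      simp only [mem_insert, mem_singleton, not_or] at hV2
      exact hφn V hV hV2.1)
    rw [sum_pair hne.symm, hφ0] at this
    have := hφ2 U hU (by omega)
    linarith
  have hsplit : ∀ {N : Type} [AddCommMonoid N] (ψ : Finset ι → N), ∑ U ∈ G, ψ U = ψ ∅ + ∑ i ∈ M, ψ {i} := by
    intro N _ ψ
    rw [sum_split (T := M) hGM (fun U hU => (hle1 U hU).trans (by norm_num)) h0 hMs]
    have : G.filter (fun U => U.card = 2) = ∅ := by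
      ext U
      simp only [mem_filter, notMem_empty, iff_false, not_and]
      intro hU
      have := hle1 U hU
      omega
    simp [this]
  have key : ∑ U ∈ G, φ U ≤ 0 := key
  rw [hsplit, hφ0, sum_congr rfl hφ1] at key
  have hwt : wt q G = 1 + ∑ i ∈ M, q i := by
    unfold wt; rw [hsplit]; simp
  have hhv : ∀ i ∈ M, (1 + q i) * q i ≤ wt q G := by
    intro i hi
    have := hv i (hMT hi)
    refine le_trans (Nat.mul_le_mul_left _ ?_) this
    unfold wt
    rw [sum_filter, hsplit]
    simp only [notMem_empty, if_false, mem_singleton, prod_singleton, zero_add]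
    rw [sum_ite_eq]
    simp [hi]
  have hq' : ∀ i ∈ M, (2 : ℤ) ≤ q i := fun i hi => by exact_mod_cast hq i (hMT hi)
  interval_cases hm : M.card
  · left
    rw [card_eq_zero] at hm
    subst hm
    ext U
    rw [mem_singleton]
    exact ⟨fun h => by simpa using hGM U h, fun h => h ▸ h0⟩
  · exfalso
    obtain ⟨a, rfl⟩ := card_eq_one.1 hm
    have := hq' a (by simp)
    simp at key
    nlinarith
  · exfalso
    obtain ⟨a, b, hab, rfl⟩ := card_eq_two.1 hm
    have h1 := hq' a (by simp)
    have h2 := hq' b (by simp)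
    rw [sum_pair hab] at key
    simp at key
    nlinarith
  · right
    obtain ⟨a, b, c, hab, hac, hbc, rfl⟩ := card_eq_three.1 hm
    have e : ∀ f : ι → ℕ, ∑ i ∈ ({a, b, c} : Finset ι), f i = f a + f b + f c := by
      intro f
      rw [sum_insert (by simp [hab, hac]), sum_pair hbc]; ring
    have e' : ∀ f : ι → ℤ, ∑ i ∈ ({a, b, c} : Finset ι), f i = f a + f b + f c := by
      intro f
      rw [sum_insert (by simp [hab, hac]), sum_pair hbc]; ring
    rw [e'] at key
    have h1 := hq' a (by simp)
    have h2 := hq' b (by simp)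
    have h3 := hq' c (by simp)
    have k1 := hhv a (by simp)
    have k2 := hhv b (by simp)
    have k3 := hhv c (by simp)
    rw [hwt, e] at k1 k2 k3
    have b1 : q a ≤ 3 := by
      have : (q a : ℤ) ≤ 3 := by push_cast at key; nlinarith
      exact_mod_cast this
    have b2 : q b ≤ 3 := by
      have : (q b : ℤ) ≤ 3 := by push_cast at key; nlinarith
      exact_mod_cast this
    have b3 : q c ≤ 3 := by
      have : (q c : ℤ) ≤ 3 := by push_cast at key; nlinarith
      exact_mod_cast this
    have h1' : 2 ≤ q a := by exact_mod_cast h1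
    have h2' : 2 ≤ q b := by exact_mod_cast h2
    have h3' : 2 ≤ q c := by exact_mod_cast h3
    have hall : q a = 2 ∧ q b = 2 ∧ q c = 2 := by
      clear key hφ hφ0 hφ1 hφ2 hφ1' hφn hsplit hwt hhv hq'
      generalize q a = x at *
      generalize q b = y at *
      generalize q c = z at *
      interval_cases x <;> interval_cases y <;> interval_cases z <;> simp_all
    refine ⟨{a, b, c}, hMT, hm, ?_, hMs, ?_⟩
    · intro i hi
      simp only [mem_insert, mem_singleton] at hi
      rcases hi with rfl | rfl | rfl
      exacts [hall.1, hall.2.1, hall.2.2]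
    · rw [hwt, e, hall.1, hall.2.1, hall.2.2]
end core2


section core3
variable {ι : Type*} [DecidableEq ι]

/-- maximality among set families -/
def SMax (T : Finset ι) (q : ι → ℕ) (s : ℕ) (F G : Finset (Finset ι)) : Prop :=
  ∀ F' G' : Finset (Finset ι), (∀ U ∈ F', U ⊆ T) → (∀ V ∈ G', V ⊆ T) →
    (∀ U ∈ F', ∀ V ∈ G', (U ∪ V).card ≤ s) → wt q F' * wt q G' ≤ wt q F * wt q G

lemma SMax.symm {T : Finset ι} {q : ι → ℕ} {s : ℕ} {F G : Finset (Finset ι)}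
    (h : SMax T q s F G) : SMax T q s G F := by
  intro F' G' h1 h2 h3
  have := h G' F' h2 h1 (fun U hU V hV => by rw [union_comm]; exact h3 V hV U hU)
  rw [mul_comm, mul_comm (wt q G)]
  exact this

lemma singles_mem {T : Finset ι} {F G : Finset (Finset ι)}
    (hF : Clo T 3 F G) (h2G : ∀ U ∈ G, U.card ≤ 2) : ∀ i ∈ T, {i} ∈ F := by
  intro i hi
  rw [hF]
  refine ⟨by simpa using hi, fun V hV => ?_⟩
  have := card_union_le {i} V
  have := h2G V hV
  simp only [card_singleton] at *
  omega

lemma cross_meet {T : Finset ι} {F G : Finset (Finset ι)}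
    (hF : Clo T 3 F G) {U V : Finset ι} (hU : U ∈ F) (hV : V ∈ G) (cU : U.card = 2)
    (cV : V.card = 2) (hd : Disjoint U V) : False := by
  have := ((hF U).1 hU).2 V hV
  rw [card_union_of_disjoint hd] at this
  omega

lemma nonstar {T : Finset ι} {q : ι → ℕ} (hq : ∀ i ∈ T, 2 ≤ q i)
    {F G : Finset (Finset ι)} (hF : Clo T 3 F G) (hG : Clo T 3 G F)
    (h2F : ∀ U ∈ F, U.card ≤ 2) (h2G : ∀ U ∈ G, U.card ≤ 2) (h0 : ∅ ∈ G)
    (hv : Heavy T q G) {a b : ι} (hab : a ≠ b) (he : {a, b} ∈ F) :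
    ∃ e ∈ F, e.card = 2 ∧ a ∉ e := by
  have hT : ({a, b} : Finset ι) ⊆ T := ((hF _).1 he).1
  have haT : a ∈ T := hT (by simp)
  have hbT : b ∈ T := hT (by simp)
  have hGT : ∀ U ∈ G, U ⊆ T := fun U hU => ((hG _).1 hU).1
  have hs := singles_mem hG h2F
  have key := heavy_sum hv hT
  rw [card_pair hab] at key
  set φ : Finset ι → ℤ := fun U => ((∏ i ∈ U, q i : ℕ) : ℤ) *
    (∑ i ∈ U ∩ {a, b}, (1 + (q i : ℤ)) - (2 : ℕ)) with hφ
  have key : ∑ U ∈ G, φ U ≤ 0 := key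
  have hq' : ∀ i ∈ T, (2 : ℤ) ≤ q i := fun i hi => by exact_mod_cast hq i hi
  by_cases hex : ∃ j ∈ T \ {a, b}, {a, j} ∉ G ∧ {b, j} ∉ G
  · obtain ⟨j, hj, h1, -⟩ := hex
    simp only [mem_sdiff, mem_insert, mem_singleton, not_or] at hj
    have hajT : ({a, j} : Finset ι) ⊆ T := by
      intro x hx
      simp only [mem_insert, mem_singleton] at hx
      rcases hx with rfl | rfl
      exacts [haT, hj.1]
    rw [hG] at h1
    push Not at h1
    obtain ⟨e, heF, hc⟩ := h1 hajT
    have hc1 := card_union_le {a, j} e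
    have hc2 := h2F e heF
    have hc3 : ({a, j} : Finset ι).card ≤ 2 := card_le_two
    refine ⟨e, heF, by omega, fun hae => ?_⟩
    have : ({a, j} : Finset ι) ∪ e = insert j e := by
      ext x; simp only [mem_union, mem_insert, mem_singleton]
      constructor
      · rintro ((rfl | rfl) | h) <;> simp_all
      · rintro (rfl | h) <;> simp_all
    rw [this] at hc
    have := card_insert_le j e
    omega
  · exfalso
    push Not at hex
    rw [sum_split hGT h2G h0 hs] at key
    have hφ0 : φ ∅ = -2 := by simp [hφ]
    have hφa : 2 ≤ φ {a} := by
      have := hq' a haT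
      have hin : ({a} : Finset ι) ∩ {a, b} = {a} := singleton_inter_of_mem (by simp)
      simp only [hφ, hin, prod_singleton, sum_singleton]
      push_cast
      nlinarith
    have hφb : 2 ≤ φ {b} := by
      have := hq' b hbT
      have hin : ({b} : Finset ι) ∩ {a, b} = {b} := singleton_inter_of_mem (by simp)
      simp only [hφ, hin, prod_singleton, sum_singleton]
      push_cast
      nlinarith
    have hφj : ∀ j ∈ T \ {a, b}, φ {j} = -2 * q j := by
      intro j hj
      simp only [mem_sdiff] at hj
      simp [hφ, singleton_inter_of_notMem hj.2]
      ring
    have hsum1 : ∑ i ∈ T, φ {i} = ∑ j ∈ T \ {a, b}, (-2 * (q j : ℤ)) + (φ {a} + φ {b}) := by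
      rw [← sum_sdiff hT, sum_pair hab, sum_congr rfl hφj]
    -- the edges
    have hpos : ∀ U ∈ G.filter (fun U => U.card = 2), 0 ≤ φ U := by
      intro U hU
      obtain ⟨hU, hc⟩ := mem_filter.1 hU
      have : ¬ Disjoint U {a, b} := fun hd =>
        cross_meet hG hU he hc (card_pair hab) hd
      rw [not_disjoint_iff_nonempty_inter] at this
      obtain ⟨i, hi⟩ := this
      have h1 : (1 + (q i : ℤ)) ≤ ∑ i ∈ U ∩ {a, b}, (1 + (q i : ℤ)) :=
        single_le_sum (f := fun i => 1 + (q i : ℤ)) (fun i _ => by positivity) hi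
      have h2 := hq' i (hT (mem_inter.1 hi).2)
      apply mul_nonneg
      · positivity
      · push_cast; linarith
    have hch : ∀ j ∈ T \ {a, b}, ∃ c ∈ ({a, b} : Finset ι), {c, j} ∈ G := by
      intro j hj
      by_cases h : {a, j} ∈ G
      · exact ⟨a, by simp, h⟩
      · exact ⟨b, by simp, hex j hj h⟩
    choose! c hcm hcG using hch
    have hsub : (T \ {a, b}).image (fun j => ({c j, j} : Finset ι)) ⊆
        G.filter (fun U => U.card = 2) := by
      intro U hU
      obtain ⟨j, hj, rfl⟩ := mem_image.1 hU
      refine mem_filter.2 ⟨hcG j hj, card_pair ?_⟩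
      intro h
      exact (mem_sdiff.1 hj).2 (h ▸ hcm j hj)
    have hle := sum_le_sum_of_subset_of_nonneg (f := φ) hsub (fun U hU _ => hpos U hU)
    rw [sum_image] at hle
    · have hge : ∑ j ∈ T \ {a, b}, 2 * (q j : ℤ) ≤ ∑ j ∈ T \ {a, b}, φ {c j, j} := by
        refine sum_le_sum fun j hj => ?_
        have hne : c j ≠ j := by
          intro h
          exact (mem_sdiff.1 hj).2 (h ▸ hcm j hj)
        have h1 := hq' _ (hT (hcm j hj))
        have h2 := hq' j (mem_sdiff.1 hj).1
        have hin : ({c j, j} : Finset ι) ∩ {a, b} = {c j} := by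
          rw [insert_inter_of_mem (hcm j hj), singleton_inter_of_notMem (mem_sdiff.1 hj).2,
            insert_empty_eq]
        simp only [hφ, hin, prod_pair hne, sum_singleton]
        push_cast
        have h3 : (2 : ℤ) ≤ q (c j) * (q (c j) - 1) := by nlinarith
        nlinarith
      have e1 : ∑ j ∈ T \ {a, b}, (-2 * (q j : ℤ)) = - ∑ j ∈ T \ {a, b}, 2 * (q j : ℤ) := by
        rw [← sum_neg_distrib]; exact sum_congr rfl fun j _ => by ring
      linarith
    · intro j hj j' hj' h
      have : j ∈ ({c j', j'} : Finset ι) := by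
        have : j ∈ ({c j, j} : Finset ι) := by simp
        rw [show ({c j, j} : Finset ι) = {c j', j'} from h] at this
        exact this
      simp only [mem_insert, mem_singleton] at this
      rcases this with h | h
      · exact absurd (h ▸ hcm j' hj') (mem_sdiff.1 hj).2
      · exact h

lemma nonstar' {T : Finset ι} {q : ι → ℕ} (hq : ∀ i ∈ T, 2 ≤ q i)
    {F G : Finset (Finset ι)} (hF : Clo T 3 F G) (hG : Clo T 3 G F)
    (h2F : ∀ U ∈ F, U.card ≤ 2) (h2G : ∀ U ∈ G, U.card ≤ 2) (h0 : ∅ ∈ G)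
    (hv : Heavy T q G) (he : ∃ e ∈ F, e.card = 2) (v : ι) :
    ∃ e ∈ F, e.card = 2 ∧ v ∉ e := by
  obtain ⟨e, heF, hc⟩ := he
  by_cases hve : v ∈ e
  · obtain ⟨a, b, hab, rfl⟩ := card_eq_two.1 hc
    simp only [mem_insert, mem_singleton] at hve
    rcases hve with rfl | rfl
    · exact nonstar hq hF hG h2F h2G h0 hv hab heF
    · rw [pair_comm] at heF
      exact nonstar hq hF hG h2F h2G h0 hv hab.symm heF
  · exact ⟨e, heF, hc, hve⟩

lemma exists_W {T : Finset ι} {F G : Finset (Finset ι)} (hF : Clo T 3 F G)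
    (hns : ∀ v, ∃ e ∈ F, e.card = 2 ∧ v ∉ e) (he : ∃ e ∈ F, e.card = 2) :
    ∃ W ⊆ T, W.card ≤ 4 ∧ ∀ V ∈ G, V.card = 2 → V ⊆ W := by
  obtain ⟨e, heF, hc⟩ := he
  obtain ⟨a, b, hab, rfl⟩ := card_eq_two.1 hc
  have hFT : ∀ U ∈ F, U ⊆ T := fun U hU => ((hF _).1 hU).1
  -- pairs of disjoint edges
  have hdis : ∀ e ∈ F, e.card = 2 → Disjoint {a, b} e →
      ∃ W ⊆ T, W.card ≤ 4 ∧ ∀ V ∈ G, V.card = 2 → V ⊆ W := by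
    intro e he hce hd
    refine ⟨{a, b} ∪ e, union_subset (hFT _ heF) (hFT _ he), ?_, ?_⟩
    · rw [card_union_of_disjoint hd]; omega
    · intro V hV cV
      have h1 : ¬ Disjoint {a, b} V := fun h => cross_meet hF heF hV hc cV h
      have h2 : ¬ Disjoint e V := fun h => cross_meet hF he hV hce cV h
      rw [not_disjoint_iff] at h1 h2
      obtain ⟨x, hx1, hx2⟩ := h1
      obtain ⟨y, hy1, hy2⟩ := h2
      have hxy : x ≠ y := by
        rintro rfl
        exact disjoint_left.1 hd hx1 hy1
      have : V = {x, y} := by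
        symm
        apply eq_of_subset_of_card_le
        · intro z hz
          simp only [mem_insert, mem_singleton] at hz
          rcases hz with rfl | rfl <;> assumption
        · rw [card_pair hxy, cV]
      rw [this]
      intro z hz
      simp only [mem_insert, mem_singleton] at hz
      rcases hz with rfl | rfl
      · exact mem_union_left _ hx1
      · exact mem_union_right _ hy1
  obtain ⟨e, he, hce, hae⟩ := hns a
  obtain ⟨e', he', hce', hbe'⟩ := hns b
  by_cases hd : Disjoint {a, b} e
  · exact hdis e he hce hd
  by_cases hd' : Disjoint {a, b} e'
  · exact hdis e' he' hce' hd'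
  refine ⟨({a, b} ∪ e) ∪ e', union_subset (union_subset (hFT _ heF) (hFT _ he)) (hFT _ he'), ?_, ?_⟩
  · have h1 : (({a, b} ∪ e : Finset ι)).card ≤ 3 := by
      have := card_union_add_card_inter {a, b} e
      rw [not_disjoint_iff_nonempty_inter] at hd
      have := card_pos.2 hd
      omega
    have h2 := card_union_add_card_inter ({a, b} ∪ e) e'
    have h3 : (({a, b} ∪ e) ∩ e').Nonempty := by
      rw [not_disjoint_iff_nonempty_inter] at hd'
      refine hd'.mono ?_
      exact inter_subset_inter_right subset_union_left
    have := card_pos.2 h3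
    omega
  · intro V hV cV x hx
    by_contra hxW
    simp only [mem_union, not_or] at hxW
    obtain ⟨y, hy, hVy⟩ : ∃ y, y ≠ x ∧ V = {x, y} := by
      obtain ⟨c, d, hcd, rfl⟩ := card_eq_two.1 cV
      simp only [mem_insert, mem_singleton] at hx
      rcases hx with rfl | rfl
      · exact ⟨d, hcd.symm, rfl⟩
      · exact ⟨c, hcd, pair_comm _ _⟩
    have hmeet : ∀ e ∈ F, e.card = 2 → x ∉ e → y ∈ e := by
      intro e he hce hxe
      by_contra hye
      refine cross_meet hF he hV hce cV ?_
      rw [hVy, disjoint_left]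
      intro z hz hz2
      simp only [mem_insert, mem_singleton] at hz2
      rcases hz2 with rfl | rfl <;> contradiction
    have m1 := hmeet _ heF hc hxW.1.1
    have m2 := hmeet _ he hce hxW.1.2
    have m3 := hmeet _ he' hce' hxW.2
    simp only [mem_insert, mem_singleton] at m1
    rcases m1 with rfl | rfl <;> contradiction

lemma edges_in_W {T W : Finset ι} {F G : Finset (Finset ι)} (hF : Clo T 3 F G)
    (hns : ∀ v, ∃ e ∈ G, e.card = 2 ∧ v ∉ e) (hW : ∀ V ∈ G, V.card = 2 → V ⊆ W) :
    ∀ U ∈ F, U.card = 2 → U ⊆ W := by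
  intro U hU cU x hx
  by_contra hxW
  obtain ⟨y, hy, hUy⟩ : ∃ y, y ≠ x ∧ U = {x, y} := by
    obtain ⟨c, d, hcd, rfl⟩ := card_eq_two.1 cU
    simp only [mem_insert, mem_singleton] at hx
    rcases hx with rfl | rfl
    · exact ⟨d, hcd.symm, rfl⟩
    · exact ⟨c, hcd, pair_comm _ _⟩
  obtain ⟨e, he, hce, hye⟩ := hns y
  refine cross_meet hF hU he cU hce ?_
  rw [hUy, disjoint_left]
  intro z hz hz2
  simp only [mem_insert, mem_singleton] at hz
  rcases hz with rfl | rfl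
  · exact hxW (hW e he hce hz2)
  · contradiction

lemma edge_weight_bound {T : Finset ι} {q : ι → ℕ} (hq : ∀ i ∈ T, 2 ≤ q i)
    {F G : Finset (Finset ι)} (hF : Clo T 3 F G)
    (h2F : ∀ U ∈ F, U.card ≤ 2) (h2G : ∀ U ∈ G, U.card ≤ 2) (h0 : ∅ ∈ F)
    (hv : Heavy T q F) {W : Finset ι} (hWT : W ⊆ T) (hWc : W.card = 4)
    (hW : ∀ V ∈ F, V.card = 2 → V ⊆ W) :
    ∑ U ∈ F.filter (fun U => U.card = 2), ∏ i ∈ U, q i ≤ 6 + 2 * ∑ i ∈ T \ W, q i := by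
  have hFT : ∀ U ∈ F, U ⊆ T := fun U hU => ((hF _).1 hU).1
  have hs := singles_mem hF h2G
  have key := heavy_sum hv hWT
  rw [hWc] at key
  set φ : Finset ι → ℤ := fun U => ((∏ i ∈ U, q i : ℕ) : ℤ) *
    (∑ i ∈ U ∩ W, (1 + (q i : ℤ)) - (4 : ℕ)) with hφ
  have key : ∑ U ∈ F, φ U ≤ 0 := key
  have hq' : ∀ i ∈ T, (2 : ℤ) ≤ q i := fun i hi => by exact_mod_cast hq i hi
  rw [sum_split hFT h2F h0 hs, ← sum_sdiff hWT] at key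
  have hφ0 : φ ∅ = -4 := by simp [hφ]
  have hφj : ∀ j ∈ T \ W, φ {j} = -4 * q j := by
    intro j hj
    simp only [mem_sdiff] at hj
    simp [hφ, singleton_inter_of_notMem hj.2]
    ring
  have hφW : ∑ j ∈ W, (-2 : ℤ) ≤ ∑ j ∈ W, φ {j} := by
    refine sum_le_sum fun j hj => ?_
    have := hq' j (hWT hj)
    simp [hφ, singleton_inter_of_mem hj]
    nlinarith
  have hE : ∑ U ∈ F.filter (fun U => U.card = 2), 2 * ((∏ i ∈ U, q i : ℕ) : ℤ) ≤
      ∑ U ∈ F.filter (fun U => U.card = 2), φ U := by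
    refine sum_le_sum fun U hU => ?_
    obtain ⟨hU, hc⟩ := mem_filter.1 hU
    have hUW := hW U hU hc
    have hs := sum_ge_of_card (q := q) (U := U) (fun i hi => hq i (hWT (hUW hi)))
    have hs' : 2 * (U.card : ℤ) ≤ ∑ i ∈ U, (q i : ℤ) := by exact_mod_cast hs
    simp only [hφ, inter_eq_left.2 hUW, sum_add_distrib]
    simp only [sum_const, nsmul_eq_mul, mul_one]
    rw [hc] at hs' ⊢
    have : (0 : ℤ) ≤ ((∏ i ∈ U, q i : ℕ) : ℤ) := by positivity
    push_cast at *
    nlinarith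
  rw [sum_congr rfl hφj, hφ0, ← mul_sum] at key
  rw [← mul_sum] at hE
  simp only [sum_const, hWc, nsmul_eq_mul] at hφW
  have hfin : ((∑ U ∈ F.filter (fun U => U.card = 2), ∏ i ∈ U, q i : ℕ) : ℤ) ≤
      ((6 + 2 * ∑ i ∈ T \ W, q i : ℕ) : ℤ) := by
    push_cast at *
    linarith
  exact_mod_cast hfin

lemma graph_case {T : Finset ι} {q : ι → ℕ} (hq : ∀ i ∈ T, 2 ≤ q i) (hT4 : 4 ≤ T.card)
    {F G : Finset (Finset ι)} (hF : Clo T 3 F G) (hG : Clo T 3 G F)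
    (h2F : ∀ U ∈ F, U.card ≤ 2) (h2G : ∀ U ∈ G, U.card ≤ 2) (h0F : ∅ ∈ F) (h0 : ∅ ∈ G)
    (hvF : Heavy T q F) (hv : Heavy T q G) (hmax : SMax T q 3 F G)
    (heF : ∃ e ∈ F, e.card = 2) (heG : ∃ e ∈ G, e.card = 2) : False := by
  have nsF := nonstar' hq hF hG h2F h2G h0 hv heF
  have nsG := nonstar' hq hG hF h2G h2F h0F hvF heG
  obtain ⟨W0, hW0T, hW0c, hW0⟩ := exists_W hF nsF heF
  obtain ⟨W, hW0W, hWT, hWc⟩ := exists_subsuperset_card_eq hW0T hW0c hT4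
  have hWG : ∀ V ∈ G, V.card = 2 → V ⊆ W := fun V hV hc => (hW0 V hV hc).trans hW0W
  have hWF := edges_in_W hF nsG hWG
  have bF := edge_weight_bound hq hF h2F h2G h0F hvF hWT hWc hWF
  have bG := edge_weight_bound hq hG h2G h2F h0 hv hWT hWc hWG
  have hm := hmax (sBall T 1) (sBall T 2) (by simp +contextual [sBall])
    (by simp +contextual [sBall]) (by
      intro U hU V hV
      simp only [sBall, mem_filter] at hU hV
      have := card_union_le U V
      omega)
  have wF : wt q F = 1 + ∑ i ∈ T, q i + ∑ U ∈ F.filter (fun U => U.card = 2), ∏ i ∈ U, q i := by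
    unfold wt
    rw [sum_split (fun U hU => ((hF _).1 hU).1) h2F h0F (singles_mem hF h2G)]
    simp [add_assoc]
  have wG : wt q G = 1 + ∑ i ∈ T, q i + ∑ U ∈ G.filter (fun U => U.card = 2), ∏ i ∈ U, q i := by
    unfold wt
    rw [sum_split (fun U hU => ((hG _).1 hU).1) h2G h0 (singles_mem hG h2F)]
    simp [add_assoc]
  rw [(sBall_split T q).1, (sBall_split T q).2, wF, wG] at hm
  have gpos : 0 < ∑ U ∈ G.filter (fun U => U.card = 2), ∏ i ∈ U, q i := by
    obtain ⟨e, he, hc⟩ := heG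
    have h1 : ∏ i ∈ e, q i ≤ ∑ U ∈ G.filter (fun U => U.card = 2), ∏ i ∈ U, q i :=
      single_le_sum (f := fun U => ∏ i ∈ U, q i) (fun _ _ => Nat.zero_le _)
        (mem_filter.2 ⟨he, hc⟩)
    have h2 := prod_ge_of_card (q := q) (U := e) (fun i hi => hq i (((hG _).1 he).1 hi))
    have : 0 < 2 ^ e.card := by positivity
    omega
  have i1 := e2_identity q T
  have i2 := e2_identity q W
  have i3 := e2_ge (q := q) (U := W) (fun i hi => hq i (hWT hi)) hWc.ge
  have i4 := sum_ge_of_card (q := q) (U := W) (fun i hi => hq i (hWT hi))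
  have i5 : ∑ i ∈ T \ W, q i ^ 2 ≤ (∑ i ∈ T \ W, q i) ^ 2 :=
    by
      have := e2_identity q (T \ W)
      omega
  rw [← sum_sdiff hWT, ← sum_sdiff hWT] at i1
  rw [← sum_sdiff hWT] at hm
  rw [hWc] at i4
  generalize ∑ U ∈ F.filter (fun U => U.card = 2), ∏ i ∈ U, q i = f at *
  generalize ∑ U ∈ G.filter (fun U => U.card = 2), ∏ i ∈ U, q i = g at *
  generalize ∑ U ∈ T.powersetCard 2, ∏ i ∈ U, q i = e at *
  generalize ∑ U ∈ W.powersetCard 2, ∏ i ∈ U, q i = e' at *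
  generalize ∑ i ∈ T \ W, q i ^ 2 = z1 at *
  generalize ∑ i ∈ W, q i ^ 2 = z2 at *
  generalize ∑ i ∈ T \ W, q i = R at *
  generalize ∑ i ∈ W, q i = Z at *
  clear * - i1 i2 i3 i4 i5 hm bF bG gpos
  have he : 24 + 8 * R ≤ e := by nlinarith
  have h1 : (1 + (R + Z)) * e ≤ (1 + (R + Z)) * (f + g) + f * g := by nlinarith
  have h2 : f * g < 2 * (1 + (R + Z)) * g := by
    apply Nat.mul_lt_mul_of_pos_right _ gpos
    omega
  have h3 : (1 + (R + Z)) * e < (1 + (R + Z)) * (f + 3 * g) := by nlinarith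
  have h4 := lt_of_mul_lt_mul_left' h3
  omega
end core3


section core4
variable {ι : Type*} [DecidableEq ι]

lemma mem_sBall {T : Finset ι} {a : ℕ} {U : Finset ι} : U ∈ sBall T a ↔ U ⊆ T ∧ U.card ≤ a := by
  simp [sBall]

lemma clo_ball {T : Finset ι} {s b : ℕ} {F : Finset (Finset ι)} (hF : Clo T s F (sBall T b))
    (hb : b ≤ s) (hs : s + 1 ≤ T.card) : F = sBall T (s - b) := by
  ext U
  rw [hF, mem_sBall]
  refine and_congr_right fun hU => ⟨fun h => ?_, fun h V hV => ?_⟩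
  · by_contra hc
    by_cases hle : s + 1 ≤ U.card
    · have := h ∅ (mem_sBall.2 ⟨by simp, by simp⟩)
      simp at this
      omega
    · have h1 : s + 1 - U.card ≤ (T \ U).card := by
        rw [card_sdiff_of_subset hU]; omega
      obtain ⟨V, hV, hVc⟩ := exists_subset_card_eq h1
      have h2 := h V (mem_sBall.2 ⟨hV.trans sdiff_subset, by omega⟩)
      rw [card_union_of_disjoint] at h2
      · omega
      · exact (disjoint_sdiff_self_right (x := U) (y := T)).mono_right hV
  · have := card_union_le U V
    have := (mem_sBall.1 hV).2
    omega

lemma core_half {T : Finset ι} {q : ι → ℕ} (hq : ∀ i ∈ T, 2 ≤ q i) {s : ℕ} (hs3 : s ≤ 3)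
    (hsT : s + 1 ≤ T.card) {F G : Finset (Finset ι)} (hF : Clo T s F G) (hG : Clo T s G F)
    (hneG : G.Nonempty) (hvG : Heavy T q G) (hmax : SMax T q s F G)
    {U : Finset ι} (hU : U ∈ F) (hc : U.card = s) : F = sBall T s ∧ G = sBall T 0 := by
  have h0 := hG.empty_mem hneG
  have hGU : ∀ V ∈ G, V ⊆ U := by
    intro V hV
    have h1 := ((hF U).1 hU).2 V hV
    have h2 : U = U ∪ V := eq_of_subset_of_card_le subset_union_left (by omega)
    rw [h2]
    exact subset_union_right
  rcases small_support hq hG h0 hvG (X := U) (by omega) hGU with h | ⟨M, hMT, hMc, hM2, hMs, hw⟩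
  · have : G = sBall T 0 := by
      rw [h]; ext V; simp only [mem_singleton, mem_sBall, Nat.le_zero, card_eq_zero]
      exact ⟨fun h => ⟨by simp [h], h⟩, fun h => h.2⟩
    subst this
    exact ⟨by simpa using clo_ball hF (Nat.zero_le _) hsT, rfl⟩
  · exfalso
    have hMU : M ⊆ U := fun i hi => hGU _ (hMs i hi) (mem_singleton_self i)
    have hs : s = 3 := by
      have := card_le_card hMU
      omega
    subst hs
    have hFs : F ⊆ insert M (sBall T 2) := by
      intro U' hU'
      rw [mem_insert, mem_sBall]
      obtain ⟨h1, h2⟩ := (hF U').1 hU'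
      by_cases h3 : U'.card ≤ 2
      · exact Or.inr ⟨h1, h3⟩
      · left
        have h4 : M ⊆ U' := by
          intro i hi
          by_contra hiU
          have := h2 _ (hMs i hi)
          rw [card_union_of_disjoint (by simpa using hiU), card_singleton] at this
          omega
        have h5 := h2 ∅ h0
        rw [union_empty] at h5
        exact (eq_of_subset_of_card_le h4 (by omega)).symm
    have hwF : wt q F ≤ 8 + wt q (sBall T 2) := by
      unfold wt
      refine (sum_le_sum_of_subset hFs).trans ?_
      rw [sum_insert]
      · rw [prod_congr rfl hM2, prod_const, hMc]; norm_num
      · rw [mem_sBall]; omega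
    have hm := hmax (sBall T 2) (sBall T 1) (by simp +contextual [sBall])
      (by simp +contextual [sBall]) (by
        intro U hU V hV
        simp only [sBall, mem_filter] at hU hV
        have := card_union_le U V
        omega)
    have e1 := (sBall_split T q).1
    have e2 := (sBall_split T q).2
    have e3 := e2_ge hq hsT
    have e4 := sum_ge_of_card hq
    rw [hw] at hm
    have h9 : 9 ≤ wt q (sBall T 1) := by omega
    have h33 : 33 ≤ wt q (sBall T 2) := by omega
    nlinarith

theorem core_thm {T : Finset ι} {q : ι → ℕ} (hq : ∀ i ∈ T, 2 ≤ q i) {s : ℕ} (hs3 : s ≤ 3)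
    (hsT : s + 1 ≤ T.card) {F G : Finset (Finset ι)} (hF : Clo T s F G) (hG : Clo T s G F)
    (hneF : F.Nonempty) (hneG : G.Nonempty) (hvF : Heavy T q F) (hvG : Heavy T q G)
    (hmax : SMax T q s F G) : ∃ a b, a + b = s ∧ F = sBall T a ∧ G = sBall T b := by
  have h0F := hF.empty_mem hneF
  have h0G := hG.empty_mem hneG
  by_cases h1 : ∃ U ∈ F, U.card = s
  · obtain ⟨U, hU, hc⟩ := h1
    have := core_half hq hs3 hsT hF hG hneG hvG hmax hU hc
    exact ⟨s, 0, by simp, this.1, this.2⟩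
  by_cases h2 : ∃ U ∈ G, U.card = s
  · obtain ⟨U, hU, hc⟩ := h2
    have := core_half hq hs3 hsT hG hF hneF hvF hmax.symm hU hc
    exact ⟨0, s, by simp, this.2, this.1⟩
  push Not at h1 h2
  have hFs : ∀ U ∈ F, U.card + 1 ≤ s := by
    intro U hU
    have := ((hF U).1 hU).2 ∅ h0G
    rw [union_empty] at this
    have := h1 U hU
    omega
  have hGs : ∀ U ∈ G, U.card + 1 ≤ s := by
    intro U hU
    have := ((hG U).1 hU).2 ∅ h0F
    rw [union_empty] at this
    have := h2 U hU
    omega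
  -- if both families have small sets, they are balls
  have key : ∀ a b, a + b = s → (∀ U ∈ F, U.card ≤ a) → (∀ V ∈ G, V.card ≤ b) →
      ∃ a b, a + b = s ∧ F = sBall T a ∧ G = sBall T b := by
    intro a b hab ha hb
    refine ⟨a, b, hab, ?_, ?_⟩
    · ext U
      rw [mem_sBall]
      refine ⟨fun h => ⟨((hF U).1 h).1, ha U h⟩, fun h => (hF U).2 ⟨h.1, fun V hV => ?_⟩⟩
      have := card_union_le U V
      have := hb V hV
      omega
    · ext U
      rw [mem_sBall]
      refine ⟨fun h => ⟨((hG U).1 h).1, hb U h⟩, fun h => (hG U).2 ⟨h.1, fun V hV => ?_⟩⟩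
      have := card_union_le U V
      have := ha V hV
      omega
  have hpos := hFs ∅ h0F
  by_cases hs : s ≤ 2
  · refine key (s - 1) 1 (by omega) (fun U hU => ?_) (fun V hV => ?_)
    · have := hFs U hU; omega
    · have := hGs V hV; omega
  have hs : s = 3 := by omega
  subst hs
  by_cases h3 : ∃ U ∈ F, U.card = 2
  · by_cases h4 : ∃ V ∈ G, V.card = 2
    · exfalso
      exact graph_case hq hsT hF hG (fun U hU => by have := hFs U hU; omega)
        (fun U hU => by have := hGs U hU; omega) h0F h0G hvF hvG hmax h3 h4
    · push Not at h4
      refine key 2 1 rfl (fun U hU => ?_) (fun V hV => ?_)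
      · have := hFs U hU; omega
      · have := hGs V hV; have := h4 V hV; omega
  · push Not at h3
    refine key 1 2 rfl (fun U hU => ?_) (fun V hV => ?_)
    · have := hFs U hU; have := h3 U hU; omega
    · have := hGs V hV; omega

lemma num_aux {x y z w E : ℕ} (hx : 2 ≤ x) (h1 : x ≤ y ∧ 2 ≤ y) (h2 : x ≤ z ∧ 2 ≤ z)
    (h3 : x ≤ w ∧ 2 ≤ w)
    (e2 : 2 * E + (x ^ 2 + (y ^ 2 + (z ^ 2 + w ^ 2))) = (x + (y + (z + w))) ^ 2)
    (hm : (1 + y) * ((1 + z) * (1 + w)) * ((1 + y) * ((1 + z) * (1 + w))) ≤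
      (1 + (x + (y + (z + w)))) * (1 + (x + (y + (z + w))) + E)) : False := by
  have hE : E = x * y + x * z + x * w + (y * z + z * w + w * y) := by clear hm; linarith
  obtain ⟨h1, h1'⟩ := h1
  obtain ⟨h2, h2'⟩ := h2
  obtain ⟨h3, h3'⟩ := h3
  have a1 : x * y ≤ y * z := by clear hm e2 hE; nlinarith
  have a2 : x * z ≤ z * w := by clear hm e2 hE; nlinarith
  have a3 : x * w ≤ w * y := by clear hm e2 hE; nlinarith
  have b1 : y + z ≤ y * z := by clear hm e2 hE; nlinarith
  have b2 : z + w ≤ z * w := by clear hm e2 hE; nlinarith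
  have b3 : w + y ≤ w * y := by clear hm e2 hE; nlinarith
  have c0 : 4 ≤ y * z := by clear hm e2 hE; nlinarith
  have c2 : 8 ≤ y * z * w := by clear hm e2 hE; nlinarith
  have hYe : (1 + y) * ((1 + z) * (1 + w)) =
    1 + (y + z + w) + (y * z + z * w + w * y) + y * z * w := by ring
  set Y := (1 + y) * ((1 + z) * (1 + w)) with hY
  have hA : 2 * (1 + (x + (y + (z + w)))) ≤ Y := by clear hm e2; linarith
  have hB : (1 + (x + (y + (z + w))) + E) < 2 * Y := by clear hm e2; linarith
  have hpos : 0 < 1 + (x + (y + (z + w))) := by omega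
  have : (1 + (x + (y + (z + w)))) * (1 + (x + (y + (z + w))) + E) < Y * Y := by
    calc _ < (1 + (x + (y + (z + w)))) * (2 * Y) := Nat.mul_lt_mul_of_pos_left hB hpos
      _ = (2 * (1 + (x + (y + (z + w))))) * Y := by ring
      _ ≤ Y * Y := Nat.mul_le_mul_right _ hA
  omega

/-- For `r = 1` balls with at least two relevant coordinates are never optimal. -/
lemma no_ball_one {T : Finset ι} {q : ι → ℕ} (hq : ∀ i ∈ T, 2 ≤ q i) {s a b : ℕ} (hs3 : s ≤ 3)
    (hs1 : 1 ≤ s) (hsT : s + 1 = T.card) (hab : a + b = s) (hle : a ≤ b)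
    (hmax : SMax T q s (sBall T a) (sBall T b)) : False := by
  obtain ⟨i, hi, hmin⟩ := exists_min_image T q (card_pos.1 (by omega))
  set T' := T.erase i with hT'
  have hcT' : T'.card = s := by rw [card_erase_of_mem hi]; omega
  have hm := hmax T'.powerset T'.powerset
    (fun U hU => (mem_powerset.1 hU).trans (erase_subset _ _))
    (fun U hU => (mem_powerset.1 hU).trans (erase_subset _ _))
    (fun U hU V hV => by
      have := card_le_card (union_subset (mem_powerset.1 hU) (mem_powerset.1 hV))
      omega)
  have hwP : ∀ X : Finset ι, wt q X.powerset = ∏ j ∈ X, (1 + q j) := by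
    intro X; unfold wt; rw [prod_one_add]
  rw [hwP] at hm
  have hTi : T = insert i T' := (insert_erase hi).symm
  have hiT' : i ∉ T' := notMem_erase i T
  have hq' : ∀ j ∈ T', q i ≤ q j ∧ 2 ≤ q j := fun j hj =>
    ⟨hmin j (mem_of_mem_erase hj), hq j (mem_of_mem_erase hj)⟩
  have hqi := hq i hi
  clear_value T'
  subst hTi
  have hcases : a = 0 ∨ (a = 1 ∧ b = 1) ∨ (a = 1 ∧ b = 2) := by omega
  rcases hcases with rfl | ⟨rfl, rfl⟩ | ⟨rfl, rfl⟩
  · have hb : b = s := by omega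
    subst hb
    have h1 : wt q (sBall (insert i T') 0) = 1 := by
      have : sBall (insert i T') 0 = {∅} := by
        ext V; simp only [mem_singleton, mem_sBall, Nat.le_zero, card_eq_zero]
        exact ⟨fun h => h.2, fun h => ⟨by simp [h], h⟩⟩
      rw [this]; simp [wt]
    have h2 : wt q (sBall (insert i T') b) < ∏ j ∈ insert i T', (1 + q j) := by
      rw [← hwP]
      unfold wt
      apply sum_lt_sum_of_subset (i := insert i T')
      · exact filter_subset _ _
      · simp
      · rw [mem_sBall]; omega
      · exact prod_pos fun j hj => by have := hq j hj; omega
      · intros; positivity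
    rw [prod_insert hiT'] at h2
    rw [h1, one_mul] at hm
    obtain ⟨j, hj⟩ := card_pos.1 (show 0 < T'.card by omega)
    have h3 : 1 + q j ≤ ∏ j ∈ T', (1 + q j) :=
      single_le_prod' (f := fun j => 1 + q j) (fun _ _ => by omega) hj
    have h4 := (hq' j hj).1
    have h5 : (1 + q i) * ∏ j ∈ T', (1 + q j) ≤ (∏ j ∈ T', (1 + q j)) * ∏ j ∈ T', (1 + q j) :=
      Nat.mul_le_mul_right _ (by omega)
    omega
  · have hs2 : T'.card = 2 := by omega
    obtain ⟨c, d, hcd, rfl⟩ := card_eq_two.1 hs2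
    rw [(sBall_split _ q).1, sum_insert hiT', sum_pair hcd, prod_pair hcd] at hm
    have h1 := hq' c (by simp)
    have h2 := hq' d (by simp)
    have h3 : 1 + (q i + (q c + q d)) < (1 + q c) * (1 + q d) := by nlinarith
    have := Nat.mul_lt_mul'' h3 h3
    omega
  · have hs2 : T'.card = 3 := by omega
    obtain ⟨c, d, e, hcd, hce, hde, rfl⟩ := card_eq_three.1 hs2
    have e2 := e2_identity q (insert i {c, d, e})
    have hc : c ∉ ({d, e} : Finset ι) := by simp [hcd, hce]
    rw [(sBall_split _ q).1, (sBall_split _ q).2] at hm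
    rw [sum_insert hiT', sum_insert hc, sum_pair hde] at hm e2
    rw [sum_insert hiT', sum_insert hc, sum_pair hde] at e2
    rw [prod_insert hc, prod_pair hde] at hm
    have h1 := hq' c (by simp)
    have h2 := hq' d (by simp)
    have h3 := hq' e (by simp)
    generalize ∑ U ∈ powersetCard 2 (insert i {c, d, e}), ∏ i ∈ U, q i = E at *
    generalize q i = x at *
    generalize q c = y at *
    generalize q d = z at *
    generalize q e = w at *
    clear * - hm e2 h1 h2 h3 hqi
    exact num_aux hqi h1 h2 h3 e2 hm
end core4


section vec1
variable {n : ℕ} {p : Fin n → ℕ}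

/-- number of disagreements within `T` -/
def dT (T : Finset (Fin n)) (x y : ∀ i, Fin (p i)) : ℕ := (T.filter (fun i => x i ≠ y i)).card

/-- support relative to `x₀` within `T` -/
def supp (T : Finset (Fin n)) (x₀ x : ∀ i, Fin (p i)) : Finset (Fin n) :=
  T.filter (fun i => x i ≠ x₀ i)

/-- the working hypothesis -/
structure Good (T : Finset (Fin n)) (s : ℕ) (x₀ : ∀ i, Fin (p i))
    (A B : Finset (∀ i, Fin (p i))) : Prop where
  cross : ∀ x ∈ A, ∀ y ∈ B, dT T x y ≤ s
  max : ∀ A' B' : Finset (∀ i, Fin (p i)), (∀ x ∈ A', ∀ y ∈ B', dT T x y ≤ s) →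
    A'.card * B'.card ≤ A.card * B.card
  neA : A.Nonempty
  neB : B.Nonempty
  hvA : ∀ i ∈ T, p i * (A.filter (fun x => x i ≠ x₀ i)).card ≤ A.card
  hvB : ∀ i ∈ T, p i * (B.filter (fun x => x i ≠ x₀ i)).card ≤ B.card

lemma dT_comm (T : Finset (Fin n)) (x y : ∀ i, Fin (p i)) : dT T x y = dT T y x := by
  unfold dT; congr 1; ext i; simp [ne_comm]

lemma dT_split {T : Finset (Fin n)} {i : Fin n} (hi : i ∈ T) (x y : ∀ i, Fin (p i)) :
    dT T x y = dT (T.erase i) x y + if x i = y i then 0 else 1 := by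
  unfold dT
  conv_lhs => rw [← insert_erase hi, filter_insert]
  split_ifs with h1 h2
  · rw [card_insert_of_notMem (by simp)]
  · rfl
  · exact absurd h2 h1

lemma dT_update {T : Finset (Fin n)} {i : Fin n} (x y : ∀ i, Fin (p i)) (c d : Fin (p i)) :
    dT (T.erase i) (Function.update x i c) (Function.update y i d) = dT (T.erase i) x y := by
  unfold dT
  congr 1
  refine filter_congr fun j hj => ?_
  have : j ≠ i := ne_of_mem_erase hj
  simp [Function.update_of_ne this]

lemma Good.symm {T : Finset (Fin n)} {s : ℕ} {x₀ : ∀ i, Fin (p i)}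
    {A B : Finset (∀ i, Fin (p i))} (h : Good T s x₀ A B) : Good T s x₀ B A where
  cross := fun x hx y hy => by rw [dT_comm]; exact h.cross y hy x hx
  max := fun A' B' hc => by
    rw [mul_comm, mul_comm B.card]
    exact h.max B' A' (fun x hx y hy => by rw [dT_comm]; exact hc y hy x hx)
  neA := h.neB
  neB := h.neA
  hvA := h.hvB
  hvB := h.hvA

lemma Good.mem_iff {T : Finset (Fin n)} {s : ℕ} {x₀ : ∀ i, Fin (p i)}
    {A B : Finset (∀ i, Fin (p i))} (h : Good T s x₀ A B) (x : ∀ i, Fin (p i)) :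
    x ∈ A ↔ ∀ y ∈ B, dT T x y ≤ s := by
  refine ⟨fun hx y hy => h.cross x hx y hy, fun hx => ?_⟩
  by_contra hxA
  have := h.max (insert x A) B (by
    intro z hz y hy
    rcases mem_insert.1 hz with rfl | hz
    · exact hx y hy
    · exact h.cross z hz y hy)
  rw [card_insert_of_notMem hxA] at this
  have := card_pos.2 h.neB
  nlinarith

/-- shifting value `m` to the central value in coordinate `i` -/
def shift (x₀ : ∀ i, Fin (p i)) (i : Fin n) (m : Fin (p i)) (A : Finset (∀ i, Fin (p i))) :
    Finset (∀ i, Fin (p i)) :=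
  univ.filter (fun x => (x i = x₀ i ∧ (x ∈ A ∨ Function.update x i m ∈ A)) ∨
    (x i = m ∧ x ∈ A ∧ Function.update x i (x₀ i) ∈ A) ∨
    (x i ≠ x₀ i ∧ x i ≠ m ∧ x ∈ A))

/-- the shifting map -/
def shmap (x₀ : ∀ i, Fin (p i)) (i : Fin n) (m : Fin (p i)) (A : Finset (∀ i, Fin (p i)))
    (x : ∀ i, Fin (p i)) : ∀ i, Fin (p i) :=
  if x i = m ∧ Function.update x i (x₀ i) ∉ A then Function.update x i (x₀ i) else x

lemma shmap_mem {x₀ : ∀ i, Fin (p i)} {i : Fin n} {m : Fin (p i)} (hm : m ≠ x₀ i)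
    {A : Finset (∀ i, Fin (p i))} {x : ∀ i, Fin (p i)} (hx : x ∈ A) :
    shmap x₀ i m A x ∈ shift x₀ i m A := by
  unfold shmap shift
  rw [mem_filter]
  refine ⟨mem_univ _, ?_⟩
  split_ifs with h
  · left
    refine ⟨by simp, Or.inr ?_⟩
    rw [Function.update_idem, ← h.1, Function.update_eq_self]
    exact hx
  · by_cases h1 : x i = x₀ i
    · exact Or.inl ⟨h1, Or.inl hx⟩
    · by_cases h2 : x i = m
      · refine Or.inr (Or.inl ⟨h2, hx, ?_⟩)
        by_contra h3
        exact h ⟨h2, h3⟩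
      · exact Or.inr (Or.inr ⟨h1, h2, hx⟩)

lemma shmap_inj {x₀ : ∀ i, Fin (p i)} {i : Fin n} {m : Fin (p i)}
    {A : Finset (∀ i, Fin (p i))} : Set.InjOn (shmap x₀ i m A) (A : Set (∀ i, Fin (p i))) := by
  intro x hx y hy hxy
  simp only [mem_coe] at hx hy
  unfold shmap at hxy
  split_ifs at hxy with h1 h2 h2
  · have : Function.update (Function.update x i (x₀ i)) i m =
      Function.update (Function.update y i (x₀ i)) i m := by rw [hxy]
    rw [Function.update_idem, Function.update_idem] at this
    nth_rewrite 1 [← h1.1] at this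
    rw [← h2.1, Function.update_eq_self, Function.update_eq_self] at this
    exact this
  · exact absurd (hxy ▸ hy) h1.2
  · exact absurd (hxy ▸ hx) h2.2
  · exact hxy

lemma shift_card {x₀ : ∀ i, Fin (p i)} {i : Fin n} {m : Fin (p i)} (hm : m ≠ x₀ i)
    (A : Finset (∀ i, Fin (p i))) : A.card ≤ (shift x₀ i m A).card :=
  card_le_card_of_injOn _ (fun _ hx => shmap_mem hm hx) shmap_inj

lemma shift_cross {T : Finset (Fin n)} {s : ℕ} {x₀ : ∀ i, Fin (p i)}
    {i : Fin n} (hi : i ∈ T) {m : Fin (p i)} (hm : m ≠ x₀ i)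
    {A B : Finset (∀ i, Fin (p i))} (h : ∀ x ∈ A, ∀ y ∈ B, dT T x y ≤ s) :
    ∀ x ∈ shift x₀ i m A, ∀ y ∈ shift x₀ i m B, dT T x y ≤ s := by
  intro x hx y hy
  have key : ∀ c d, Function.update x i c ∈ A → Function.update y i d ∈ B →
      dT (T.erase i) x y + (if c = d then 0 else 1) ≤ s := by
    intro c d hc hd
    have := h _ hc _ hd
    rw [dT_split hi, dT_update] at this
    simpa using this
  have hX : ∀ (A : Finset (∀ i, Fin (p i))) (x : ∀ i, Fin (p i)), x ∈ shift x₀ i m A →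
      (x i = x₀ i ∧ (Function.update x i (x₀ i) ∈ A ∨ Function.update x i m ∈ A)) ∨
      (x i = m ∧ Function.update x i m ∈ A ∧ Function.update x i (x₀ i) ∈ A) ∨
      (x i ≠ x₀ i ∧ x i ≠ m ∧ Function.update x i (x i) ∈ A) := by
    intro A x hx
    have hx := (mem_filter.1 hx).2
    rcases hx with ⟨h1, h2⟩ | ⟨h1, h2⟩ | h
    · left
      refine ⟨h1, ?_⟩
      nth_rewrite 1 [← h1]
      rwa [Function.update_eq_self]
    · right; left
      refine ⟨h1, ?_⟩
      nth_rewrite 1 [← h1]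
      rwa [Function.update_eq_self]
    · right; right
      rwa [Function.update_eq_self]
  rw [dT_split hi]
  generalize dT (T.erase i) x y = D at *
  have hx := hX A x hx
  have hy := hX B y hy
  clear hX h
  generalize x i = xi at *
  generalize y i = yi at *
  grind

lemma Good.shift_cards {T : Finset (Fin n)} {s : ℕ} {x₀ : ∀ i, Fin (p i)}
    {A B : Finset (∀ i, Fin (p i))} (h : Good T s x₀ A B) {i : Fin n} (hi : i ∈ T)
    {m : Fin (p i)} (hm : m ≠ x₀ i) :
    (shift x₀ i m A).card = A.card ∧ (shift x₀ i m B).card = B.card := by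
  have h1 := shift_card hm A
  have h2 := shift_card hm B
  have h3 := h.max _ _ (shift_cross hi hm h.cross)
  have h4 := card_pos.2 h.neA
  have h5 := card_pos.2 h.neB
  constructor <;> nlinarith

lemma shift_eq_image {x₀ : ∀ i, Fin (p i)} {i : Fin n} {m : Fin (p i)} (hm : m ≠ x₀ i)
    {A : Finset (∀ i, Fin (p i))} (hc : (shift x₀ i m A).card = A.card) :
    shift x₀ i m A = A.image (shmap x₀ i m A) := by
  symm
  apply eq_of_subset_of_card_le
  · intro y hy
    obtain ⟨x, hx, rfl⟩ := mem_image.1 hy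
    exact shmap_mem hm hx
  · rw [card_image_of_injOn shmap_inj, hc]

lemma shmap_ne {x₀ : ∀ i, Fin (p i)} {i : Fin n} {m : Fin (p i)}
    {A : Finset (∀ i, Fin (p i))} {x : ∀ i, Fin (p i)} {j : Fin n}
    (h : shmap x₀ i m A x j ≠ x₀ j) : x j ≠ x₀ j := by
  unfold shmap at h
  split_ifs at h with h1
  · by_cases hj : j = i
    · subst hj; simp at h
    · rwa [Function.update_of_ne hj] at h
  · exact h

lemma shift_hv {x₀ : ∀ i, Fin (p i)} {i : Fin n} {m : Fin (p i)} (hm : m ≠ x₀ i)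
    {A : Finset (∀ i, Fin (p i))} (hc : (shift x₀ i m A).card = A.card) (j : Fin n) :
    ((shift x₀ i m A).filter (fun x => x j ≠ x₀ j)).card ≤
      (A.filter (fun x => x j ≠ x₀ j)).card := by
  rw [shift_eq_image hm hc]
  refine le_trans (card_le_card ?_) (card_image_le (f := shmap x₀ i m A))
  intro y hy
  obtain ⟨hy, hne⟩ := mem_filter.1 hy
  obtain ⟨x, hx, rfl⟩ := mem_image.1 hy
  exact mem_image.2 ⟨x, mem_filter.2 ⟨hx, shmap_ne hne⟩, rfl⟩

lemma Good.shift {T : Finset (Fin n)} {s : ℕ} {x₀ : ∀ i, Fin (p i)}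
    {A B : Finset (∀ i, Fin (p i))} (h : Good T s x₀ A B) {i : Fin n} (hi : i ∈ T)
    {m : Fin (p i)} (hm : m ≠ x₀ i) : Good T s x₀ (shift x₀ i m A) (shift x₀ i m B) := by
  obtain ⟨hA, hB⟩ := h.shift_cards hi hm
  refine ⟨shift_cross hi hm h.cross, ?_, ?_, ?_, ?_, ?_⟩
  · rw [hA, hB]; exact h.max
  · rw [← card_pos, hA]; exact card_pos.2 h.neA
  · rw [← card_pos, hB]; exact card_pos.2 h.neB
  · intro j hj
    rw [hA]
    exact le_trans (Nat.mul_le_mul_left _ (shift_hv hm hA j)) (h.hvA j hj)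
  · intro j hj
    rw [hB]
    exact le_trans (Nat.mul_le_mul_left _ (shift_hv hm hB j)) (h.hvB j hj)

/-- potential -/
def pot (T : Finset (Fin n)) (x₀ : ∀ i, Fin (p i)) (A : Finset (∀ i, Fin (p i))) : ℕ :=
  ∑ x ∈ A, (supp T x₀ x).card

lemma supp_shmap {T : Finset (Fin n)} {x₀ : ∀ i, Fin (p i)} {i : Fin n} {m : Fin (p i)}
    {A : Finset (∀ i, Fin (p i))} (x : ∀ i, Fin (p i)) :
    supp T x₀ (shmap x₀ i m A x) ⊆ supp T x₀ x := by
  intro j hj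
  obtain ⟨h1, h2⟩ := mem_filter.1 hj
  exact mem_filter.2 ⟨h1, shmap_ne h2⟩

lemma pot_le {T : Finset (Fin n)} {x₀ : ∀ i, Fin (p i)} {i : Fin n} {m : Fin (p i)}
    (hm : m ≠ x₀ i) {A : Finset (∀ i, Fin (p i))} (hc : (shift x₀ i m A).card = A.card) :
    pot T x₀ (shift x₀ i m A) ≤ pot T x₀ A := by
  unfold pot
  rw [shift_eq_image hm hc, sum_image shmap_inj]
  exact sum_le_sum fun x _ => card_le_card (supp_shmap x)

lemma pot_lt {T : Finset (Fin n)} {x₀ : ∀ i, Fin (p i)} {i : Fin n} (hi : i ∈ T) {m : Fin (p i)}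
    (hm : m ≠ x₀ i) {A : Finset (∀ i, Fin (p i))} (hc : (shift x₀ i m A).card = A.card)
    (hne : shift x₀ i m A ≠ A) :
    pot T x₀ (shift x₀ i m A) < pot T x₀ A := by
  unfold pot
  obtain ⟨x, hx, hxne⟩ : ∃ x ∈ A, shmap x₀ i m A x ≠ x := by
    by_contra hcon
    push Not at hcon
    apply hne
    rw [shift_eq_image hm hc]
    ext y
    rw [mem_image]
    constructor
    · rintro ⟨x, hx, rfl⟩
      rw [hcon x hx]; exact hx
    · intro hy
      exact ⟨y, hy, hcon y hy⟩
  rw [shift_eq_image hm hc, sum_image shmap_inj]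
  refine sum_lt_sum (fun x _ => card_le_card (supp_shmap x)) ⟨x, hx, card_lt_card ?_⟩
  refine ⟨supp_shmap x, fun hsub => ?_⟩
  unfold shmap at hxne hsub
  split_ifs at hxne hsub with h1
  · have : i ∈ supp T x₀ x := mem_filter.2 ⟨hi, by rw [h1.1]; exact hm⟩
    have := (mem_filter.1 (hsub this)).2
    simp at this
  · exact hxne rfl
end vec1


section vec2
variable {n : ℕ} {p : Fin n → ℕ}

lemma supp_sub (T : Finset (Fin n)) (x₀ x : ∀ i, Fin (p i)) : supp T x₀ x ⊆ T := filter_subset _ _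

lemma mem_supp {T : Finset (Fin n)} {x₀ x : ∀ i, Fin (p i)} {i : Fin n} :
    i ∈ supp T x₀ x ↔ i ∈ T ∧ x i ≠ x₀ i := mem_filter

lemma dT_le_union (T : Finset (Fin n)) (x₀ x y : ∀ i, Fin (p i)) :
    dT T x y ≤ (supp T x₀ x ∪ supp T x₀ y).card := by
  refine card_le_card fun i hi => ?_
  obtain ⟨h1, h2⟩ := mem_filter.1 hi
  rw [mem_union, mem_supp, mem_supp]
  by_contra hc
  push Not at hc
  exact h2 ((hc.1 h1).trans (hc.2 h1).symm)

/-- vector with prescribed support -/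
def vec (x₀ alt : ∀ i, Fin (p i)) (U : Finset (Fin n)) : ∀ i, Fin (p i) :=
  fun i => if i ∈ U then alt i else x₀ i

lemma supp_vec {T : Finset (Fin n)} {x₀ alt : ∀ i, Fin (p i)} (halt : ∀ i, alt i ≠ x₀ i)
    {U : Finset (Fin n)} (hU : U ⊆ T) : supp T x₀ (vec x₀ alt U) = U := by
  ext i
  rw [mem_supp]
  unfold vec
  split_ifs with h
  · exact ⟨fun _ => h, fun _ => ⟨hU h, halt i⟩⟩
  · simp [h]

lemma exists_alt (hp : ∀ i, 3 ≤ p i) (x₀ : ∀ i, Fin (p i)) :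
    ∃ alt : ∀ i, Fin (p i), ∀ i, alt i ≠ x₀ i := by
  have : ∀ i, ∃ m : Fin (p i), m ≠ x₀ i := fun i => by
    haveI : Nontrivial (Fin (p i)) := Fin.nontrivial_iff_two_le.2 (by have := hp i; omega)
    exact exists_ne _
  exact ⟨fun i => (this i).choose, fun i => (this i).choose_spec⟩

lemma card_fiber {T : Finset (Fin n)} {x₀ : ∀ i, Fin (p i)} {U : Finset (Fin n)} (hU : U ⊆ T) :
    (univ.filter (fun x : ∀ i, Fin (p i) => supp T x₀ x = U)).card =
      (∏ i ∈ Tᶜ, p i) * ∏ i ∈ U, (p i - 1) := by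
  have h1 : univ.filter (fun x : ∀ i, Fin (p i) => supp T x₀ x = U) =
      Fintype.piFinset (fun i => if i ∈ U then univ.erase (x₀ i) else
        if i ∈ T then {x₀ i} else univ) := by
    ext x
    rw [mem_filter, Fintype.mem_piFinset, Finset.ext_iff]
    simp only [mem_univ, true_and, mem_supp]
    refine forall_congr' fun i => ?_
    have := @hU i
    split_ifs with h1 h2
    · simp [h1, this h1]
    · simp [h1, h2]
    · simp [h1, h2]
  rw [h1, Fintype.card_piFinset]
  have h2 : ∀ i, (if i ∈ U then univ.erase (x₀ i) else if i ∈ T then {x₀ i} else univ).card =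
      (if i ∈ Tᶜ then p i else 1) * (if i ∈ U then (p i - 1) else 1) := by
    intro i
    have := @hU i
    by_cases h1 : i ∈ U
    · simp [h1, this h1]
    · by_cases h2 : i ∈ T <;> simp [h1, h2]
  rw [prod_congr rfl (fun i _ => h2 i), prod_mul_distrib, prod_ite_mem, prod_ite_mem,
    univ_inter, univ_inter]

lemma card_family {T : Finset (Fin n)} {x₀ : ∀ i, Fin (p i)} {F : Finset (Finset (Fin n))}
    (hF : ∀ U ∈ F, U ⊆ T) :
    (univ.filter (fun x : ∀ i, Fin (p i) => supp T x₀ x ∈ F)).card =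
      (∏ i ∈ Tᶜ, p i) * wt (fun i => p i - 1) F := by
  rw [card_eq_sum_card_fiberwise (f := supp T x₀) (t := F)]
  · rw [wt, mul_sum]
    refine sum_congr rfl fun U hU => ?_
    rw [← card_fiber (x₀ := x₀) (hF U hU), filter_filter]
    congr 1
    refine filter_congr fun x _ => ?_
    exact ⟨fun h => h.2, fun h => ⟨h ▸ hU, h⟩⟩
  · intro x hx
    exact (mem_filter.1 hx).2

lemma down_piecewise {T : Finset (Fin n)} {x₀ : ∀ i, Fin (p i)} {A : Finset (∀ i, Fin (p i))}
    (hs : ∀ i ∈ T, ∀ x ∈ A, Function.update x i (x₀ i) ∈ A) {x : ∀ i, Fin (p i)} (hx : x ∈ A)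
    (W : Finset (Fin n)) (hW : W ⊆ T) : W.piecewise x₀ x ∈ A := by
  induction W using Finset.induction_on with
  | empty => simpa using hx
  | insert j W hj ih =>
    rw [piecewise_insert]
    exact hs j (hW (mem_insert_self _ _)) _ (ih ((subset_insert _ _).trans hW))

lemma Good.union_le {T : Finset (Fin n)} {s : ℕ} {x₀ : ∀ i, Fin (p i)}
    {A B : Finset (∀ i, Fin (p i))} (h : Good T s x₀ A B)
    (hs : ∀ i ∈ T, ∀ x ∈ B, Function.update x i (x₀ i) ∈ B)
    {x y : ∀ i, Fin (p i)} (hx : x ∈ A) (hy : y ∈ B) :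
    (supp T x₀ x ∪ supp T x₀ y).card ≤ s := by
  refine le_trans (card_le_card ?_) (h.cross x hx _
    (down_piecewise hs hy (T.filter (fun i => y i = x i)) (filter_subset _ _)))
  intro i hi
  rw [mem_union, mem_supp, mem_supp] at hi
  have hiT : i ∈ T := by tauto
  rw [mem_filter]
  refine ⟨hiT, ?_⟩
  by_cases hxy : y i = x i
  · rw [piecewise_eq_of_mem _ _ _ (mem_filter.2 ⟨hiT, hxy⟩)]
    rw [hxy] at hi
    tauto
  · rw [piecewise_eq_of_notMem _ _ _ (by simp [hxy])]
    exact fun h => hxy h.symm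

lemma Good.mem_image {T : Finset (Fin n)} {s : ℕ} {x₀ : ∀ i, Fin (p i)}
    {A B : Finset (∀ i, Fin (p i))} (h : Good T s x₀ A B)
    (hs : ∀ i ∈ T, ∀ x ∈ B, Function.update x i (x₀ i) ∈ B) (x : ∀ i, Fin (p i)) :
    x ∈ A ↔ supp T x₀ x ∈ A.image (supp T x₀) := by
  refine ⟨fun hx => mem_image_of_mem _ hx, fun hx => ?_⟩
  obtain ⟨z, hz, hzx⟩ := Finset.mem_image.1 hx
  rw [h.mem_iff]
  intro y hy
  refine (dT_le_union T x₀ x y).trans ?_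
  rw [← hzx]
  exact h.union_le hs hz hy

lemma Good.clo {T : Finset (Fin n)} {s : ℕ} {x₀ alt : ∀ i, Fin (p i)} (halt : ∀ i, alt i ≠ x₀ i)
    {A B : Finset (∀ i, Fin (p i))} (h : Good T s x₀ A B)
    (hs : ∀ i ∈ T, ∀ x ∈ B, Function.update x i (x₀ i) ∈ B) :
    Clo T s (A.image (supp T x₀)) (B.image (supp T x₀)) := by
  intro U
  constructor
  · intro hU
    obtain ⟨z, hz, rfl⟩ := Finset.mem_image.1 hU
    refine ⟨supp_sub _ _ _, ?_⟩
    intro V hV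
    obtain ⟨y, hy, rfl⟩ := Finset.mem_image.1 hV
    exact h.union_le hs hz hy
  · rintro ⟨hU, hV⟩
    rw [← supp_vec halt hU, ← h.mem_image hs, h.mem_iff]
    intro y hy
    refine (dT_le_union T x₀ _ y).trans ?_
    rw [supp_vec halt hU]
    exact hV _ (mem_image_of_mem _ hy)

lemma Good.card_eq {T : Finset (Fin n)} {s : ℕ} {x₀ : ∀ i, Fin (p i)}
    {A B : Finset (∀ i, Fin (p i))} (h : Good T s x₀ A B)
    (hs : ∀ i ∈ T, ∀ x ∈ B, Function.update x i (x₀ i) ∈ B) :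
    A.card = (∏ i ∈ Tᶜ, p i) * wt (fun i => p i - 1) (A.image (supp T x₀)) := by
  rw [← card_family (x₀ := x₀)]
  · congr 1
    ext x
    rw [mem_filter, ← h.mem_image hs]
    simp
  · intro U hU
    obtain ⟨z, hz, rfl⟩ := Finset.mem_image.1 hU
    exact supp_sub _ _ _

lemma Good.heavy (hp : ∀ i, 3 ≤ p i) {T : Finset (Fin n)} {s : ℕ} {x₀ : ∀ i, Fin (p i)}
    {A B : Finset (∀ i, Fin (p i))} (h : Good T s x₀ A B)
    (hs : ∀ i ∈ T, ∀ x ∈ B, Function.update x i (x₀ i) ∈ B) :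
    Heavy T (fun i => p i - 1) (A.image (supp T x₀)) := by
  intro i hi
  have h1 := h.hvA i hi
  have h2 : (A.filter (fun x => x i ≠ x₀ i)).card = (∏ i ∈ Tᶜ, p i) *
      wt (fun i => p i - 1) ((A.image (supp T x₀)).filter (fun U => i ∈ U)) := by
    rw [← card_family (x₀ := x₀)]
    · congr 1
      ext x
      rw [mem_filter, mem_filter, mem_filter, ← h.mem_image hs, mem_supp]
      simp [hi]
    · intro U hU
      obtain ⟨z, hz, rfl⟩ := Finset.mem_image.1 (mem_filter.1 hU).1
      exact supp_sub _ _ _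
  rw [h2, h.card_eq hs] at h1
  have hc : 0 < ∏ i ∈ Tᶜ, p i := prod_pos fun j _ => by have := hp j; omega
  have h3 : 1 + (p i - 1) = p i := by have := hp i; omega
  simp only [h3]
  refine Nat.le_of_mul_le_mul_left ?_ hc
  linarith

lemma Good.smax (hp : ∀ i, 3 ≤ p i) {T : Finset (Fin n)} {s : ℕ} {x₀ : ∀ i, Fin (p i)}
    {A B : Finset (∀ i, Fin (p i))} (h : Good T s x₀ A B)
    (hsA : ∀ i ∈ T, ∀ x ∈ A, Function.update x i (x₀ i) ∈ A)
    (hsB : ∀ i ∈ T, ∀ x ∈ B, Function.update x i (x₀ i) ∈ B) :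
    SMax T (fun i => p i - 1) s (A.image (supp T x₀)) (B.image (supp T x₀)) := by
  intro F G hF hG hFG
  have h1 := h.max (univ.filter (fun x => supp T x₀ x ∈ F)) (univ.filter (fun x => supp T x₀ x ∈ G))
    (fun x hx y hy => (dT_le_union T x₀ x y).trans
      (hFG _ (mem_filter.1 hx).2 _ (mem_filter.1 hy).2))
  rw [card_family hF, card_family hG, h.card_eq hsB, h.symm.card_eq hsA] at h1
  have hc : 0 < ∏ i ∈ Tᶜ, p i := prod_pos fun j _ => by have := hp j; omega
  refine Nat.le_of_mul_le_mul_left ?_ (Nat.mul_pos hc hc)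
  linarith

/-- the fully shifted case -/
lemma Good.stable (hp : ∀ i, 3 ≤ p i) {T : Finset (Fin n)} {s : ℕ} (hs3 : s ≤ 3)
    (hsT : s + 1 ≤ T.card) {x₀ : ∀ i, Fin (p i)}
    {A B : Finset (∀ i, Fin (p i))} (h : Good T s x₀ A B)
    (hsA : ∀ i ∈ T, ∀ x ∈ A, Function.update x i (x₀ i) ∈ A)
    (hsB : ∀ i ∈ T, ∀ x ∈ B, Function.update x i (x₀ i) ∈ B) :
    (∃ a b, a + b = s ∧ A = hBall T x₀ a ∧ B = hBall T x₀ b) ∧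
      (1 ≤ s → s + 1 = T.card → False) := by
  obtain ⟨alt, halt⟩ := exists_alt hp x₀
  have hq : ∀ i ∈ T, 2 ≤ p i - 1 := fun i _ => by have := hp i; omega
  have hm := h.smax hp hsA hsB
  obtain ⟨a, b, hab, hFa, hGb⟩ := core_thm hq hs3 hsT (h.clo halt hsB) (h.symm.clo halt hsA)
    (h.neA.image _) (h.neB.image _) (h.heavy hp hsB) (h.symm.heavy hp hsA) hm
  constructor
  · refine ⟨a, b, hab, ?_, ?_⟩
    · ext x
      rw [h.mem_image hsB, hFa, mem_sBall, hBall, mem_filter]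
      simp [supp_sub, supp]
    · ext x
      rw [h.symm.mem_image hsA, hGb, mem_sBall, hBall, mem_filter]
      simp [supp_sub, supp]
  · intro hs1 hst
    rw [hFa, hGb] at hm
    rcases le_total a b with hle | hle
    · exact no_ball_one hq hs3 hs1 hst hab hle hm
    · exact no_ball_one hq hs3 hs1 hst (by omega) hle hm.symm
end vec2


section vec3
variable {n : ℕ} {p : Fin n → ℕ}

lemma set_connect {ι : Type*} [DecidableEq ι] {S : Finset ι} {a : ℕ} {R : Finset ι → Prop}
    (step : ∀ U U', U ⊆ S → U' ⊆ S → U.card = a → U'.card = a → (U ∪ U').card ≤ a + 1 → R U → R U') :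
    ∀ (d : ℕ) (U U' : Finset ι), U ⊆ S → U' ⊆ S → U.card = a → U'.card = a → (U' \ U).card = d →
      R U → R U' := by
  intro d
  induction d with
  | zero =>
    intro U U' hU hU' hc hc' hd hR
    have h1 : U' ⊆ U := sdiff_eq_empty_iff_subset.1 (card_eq_zero.1 hd)
    have : U' = U := eq_of_subset_of_card_le h1 (by omega)
    rwa [this]
  | succ d ih =>
    intro U U' hU hU' hc hc' hd hR
    have h2 : (U \ U').card = d + 1 := by
      have e1 := card_sdiff_add_card_inter U U'
      have e2 := card_sdiff_add_card_inter U' U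
      rw [inter_comm] at e2
      omega
    obtain ⟨u', hu'⟩ : (U' \ U).Nonempty := card_pos.1 (by omega)
    obtain ⟨u, hu⟩ : (U \ U').Nonempty := card_pos.1 (by omega)
    rw [mem_sdiff] at hu hu'
    set W := insert u' (U.erase u) with hW
    have hWS : W ⊆ S := insert_subset (hU' hu'.1) ((erase_subset _ _).trans hU)
    have hWc : W.card = a := by
      rw [hW, card_insert_of_notMem (fun h => hu'.2 (mem_of_mem_erase h)), card_erase_of_mem hu.1]
      have := card_pos.2 ⟨u, hu.1⟩
      omega
    have hRW : R W := by
      refine step U W hU hWS hc hWc ?_ hR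
      have : U ∪ W ⊆ insert u' U := by
        intro z hz
        simp only [hW, mem_union, mem_insert, mem_erase] at hz ⊢
        tauto
      refine (card_le_card this).trans ((card_insert_le _ _).trans (by omega))
    refine ih W U' hWS hU' hWc hc' ?_ hRW
    have : U' \ W = (U' \ U).erase u' := by
      ext z
      simp only [hW, mem_sdiff, mem_insert, mem_erase]
      by_cases hzu : z = u
      · subst hzu; tauto
      · tauto
    rw [this, card_erase_of_mem (mem_sdiff.2 hu')]
    omega

lemma mem_hBall {T : Finset (Fin n)} {x₀ x : ∀ i, Fin (p i)} {a : ℕ} :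
    x ∈ hBall T x₀ a ↔ (supp T x₀ x).card ≤ a := by
  simp [hBall, supp]

lemma unshift_or {T : Finset (Fin n)} {x₀ : ∀ i, Fin (p i)} {i : Fin n}
    {m : Fin (p i)} (hm : m ≠ x₀ i) {A : Finset (∀ i, Fin (p i))} {a : ℕ}
    (hA : shift x₀ i m A = hBall T x₀ a) {x : ∀ i, Fin (p i)} (hx : x i = x₀ i)
    (hc : (supp T x₀ x).card = a) (hxA : x ∉ A) : Function.update x i m ∈ A := by
  have h1 : x ∈ shift x₀ i m A := by rw [hA, mem_hBall]; omega
  rcases (mem_filter.1 h1).2 with ⟨_, h⟩ | ⟨h, _⟩ | ⟨h, _⟩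
  · tauto
  · exact absurd (h.symm.trans hx) hm
  · exact absurd hx h

lemma supp_update_le {T : Finset (Fin n)} {x₀ : ∀ i, Fin (p i)} {i : Fin n}
    {m : Fin (p i)} {x : ∀ i, Fin (p i)} :
    (supp T x₀ (Function.update x i m)).card ≤ (supp T x₀ x).card + 1 := by
  refine (card_le_card (t := insert i (supp T x₀ x)) ?_).trans (card_insert_le _ _)
  intro j hj
  rw [mem_supp] at hj
  rw [mem_insert, mem_supp]
  by_cases hji : j = i
  · exact Or.inl hji
  · rw [Function.update_of_ne hji] at hj
    exact Or.inr hj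

lemma unshift_both {T : Finset (Fin n)} {x₀ : ∀ i, Fin (p i)} {i : Fin n}
    {m : Fin (p i)} (hm : m ≠ x₀ i) {A : Finset (∀ i, Fin (p i))} {a : ℕ}
    (hA : shift x₀ i m A = hBall T x₀ a) {x : ∀ i, Fin (p i)} (hx : x i = x₀ i)
    (hc : (supp T x₀ x).card < a) : x ∈ A ∧ Function.update x i m ∈ A := by
  have h1 : Function.update x i m ∈ shift x₀ i m A := by
    rw [hA, mem_hBall]
    have := supp_update_le (T := T) (x₀ := x₀) (i := i) (m := m) (x := x)
    omega
  rcases (mem_filter.1 h1).2 with ⟨h, _⟩ | ⟨_, h⟩ | ⟨_, h, _⟩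
  · rw [Function.update_self] at h
    exact absurd h hm
  · refine ⟨?_, h.1⟩
    have := h.2
    rw [Function.update_idem, ← hx, Function.update_eq_self] at this
    exact this
  · rw [Function.update_self] at h
    exact absurd rfl h

lemma unshift_eq {T : Finset (Fin n)} {x₀ : ∀ i, Fin (p i)} {i : Fin n}
    {m : Fin (p i)} (hm : m ≠ x₀ i) {A : Finset (∀ i, Fin (p i))} {a : ℕ}
    (hA : shift x₀ i m A = hBall T x₀ a)
    (hall : ∀ x : ∀ i, Fin (p i), x i = x₀ i → (supp T x₀ x).card = a → x ∈ A)
    (hc : (shift x₀ i m A).card = A.card) : shift x₀ i m A = A := by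
  refine eq_of_subset_of_card_le ?_ hc.ge
  intro z hz
  have hzb : (supp T x₀ z).card ≤ a := by rwa [hA, mem_hBall] at hz
  rcases (mem_filter.1 hz).2 with ⟨h, _⟩ | ⟨_, h, _⟩ | ⟨_, _, h⟩
  · rcases hzb.lt_or_eq with h1 | h1
    · exact (unshift_both hm hA h h1).1
    · exact hall z h h1
  · exact h
  · exact h

lemma unshift_ex (hp : ∀ i, 3 ≤ p i) {T : Finset (Fin n)} {x₀ : ∀ i, Fin (p i)} {i : Fin n}
    {m : Fin (p i)} (hm : m ≠ x₀ i) {A : Finset (∀ i, Fin (p i))} {a : ℕ}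
    (hA : shift x₀ i m A = hBall T x₀ a) (hne : A.Nonempty)
    (hv : p i * (A.filter (fun x => x i ≠ x₀ i)).card ≤ A.card) :
    ∃ x : ∀ i, Fin (p i), x i = x₀ i ∧ (supp T x₀ x).card = a ∧ x ∈ A := by
  by_contra hcon
  push Not at hcon
  have h1 : (A.filter (fun x => x i = x₀ i)).card ≤ (A.filter (fun x => x i ≠ x₀ i)).card := by
    refine card_le_card_of_injOn (fun x => Function.update x i m) ?_ ?_
    · intro x hx
      obtain ⟨hxA, hxi⟩ := mem_filter.1 hx
      have h2 : x ∈ shift x₀ i m A := mem_filter.2 ⟨mem_univ _, Or.inl ⟨hxi, Or.inl hxA⟩⟩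
      rw [hA, mem_hBall] at h2
      have h3 : (supp T x₀ x).card ≠ a := fun h => hcon x hxi h hxA
      refine mem_filter.2 ⟨(unshift_both hm hA hxi (by omega)).2, ?_⟩
      simpa using hm
    · intro x hx y hy hxy
      have hxi := (mem_filter.1 hx).2
      have hyi := (mem_filter.1 hy).2
      funext j
      by_cases hj : j = i
      · subst hj; rw [hxi, hyi]
      · have := congrFun hxy j
        simpa [Function.update_of_ne hj] using this
  have h2 := card_filter_add_card_filter_not (s := A) (fun x => x i = x₀ i)
  have h3 := card_pos.2 hne
  have h4 := hp i
  have h5 : 3 * (A.filter (fun x => x i ≠ x₀ i)).card ≤ A.card :=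
    (Nat.mul_le_mul_right _ h4).trans hv
  simp only [ne_eq] at *
  omega

lemma unshift_disj {T : Finset (Fin n)} {s : ℕ} {x₀ : ∀ i, Fin (p i)}
    {A B : Finset (∀ i, Fin (p i))} (h : Good T s x₀ A B) {i : Fin n} (hi : i ∈ T)
    {m : Fin (p i)} (hm : m ≠ x₀ i) {a b : ℕ} (hab : a + b = s)
    (hB : shift x₀ i m B = hBall T x₀ b) {x y : ∀ i, Fin (p i)} (hx : x i = x₀ i) (hy : y i = x₀ i)
    (hcx : (supp T x₀ x).card = a) (hcy : (supp T x₀ y).card = b)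
    (hd : Disjoint (supp T x₀ x) (supp T x₀ y)) (hxA : x ∈ A) : y ∈ B := by
  by_contra hyB
  have h1 := h.cross x hxA _ (unshift_or hm hB hy hcy hyB)
  have h2 : insert i (supp T x₀ x ∪ supp T x₀ y) ⊆
      T.filter (fun j => x j ≠ Function.update y i m j) := by
    intro j hj
    rw [mem_filter]
    rw [mem_insert] at hj
    by_cases hji : j = i
    · subst hji
      refine ⟨hi, ?_⟩
      rw [Function.update_self, hx]; exact hm.symm
    · rw [Function.update_of_ne hji]
      have hj := hj.resolve_left hji
      rcases mem_union.1 hj with hj | hj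
      · have h3 := disjoint_left.1 hd hj
        rw [mem_supp] at hj h3
        have : y j = x₀ j := by tauto
        rw [this]; exact hj
      · have h3 := disjoint_right.1 hd hj
        rw [mem_supp] at hj h3
        have : x j = x₀ j := by tauto
        rw [this]; exact ⟨hj.1, hj.2.symm⟩
  have h3 := card_le_card h2
  rw [card_insert_of_notMem (by simp [mem_supp, hx, hy]), card_union_of_disjoint hd] at h3
  unfold dT at h1
  omega

lemma unshift (hp : ∀ i, 3 ≤ p i) {T : Finset (Fin n)} {s : ℕ} {x₀ : ∀ i, Fin (p i)}
    {A B : Finset (∀ i, Fin (p i))} (h : Good T s x₀ A B) {i : Fin n} (hi : i ∈ T)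
    {m : Fin (p i)} (hm : m ≠ x₀ i) {a b : ℕ} (hab : a + b = s) (hsT : s + 2 ≤ T.card)
    (hA : shift x₀ i m A = hBall T x₀ a) (hB : shift x₀ i m B = hBall T x₀ b) :
    shift x₀ i m A = A ∧ shift x₀ i m B = B := by
  obtain ⟨alt, halt⟩ := exists_alt hp x₀
  obtain ⟨cA, cB⟩ := h.shift_cards hi hm
  have hTi : (T.erase i).card = T.card - 1 := card_erase_of_mem hi
  have hvec : ∀ (W : Finset (Fin n)) (c : ℕ), c + W.card + 1 ≤ T.card →
      ∃ y : ∀ i, Fin (p i), y i = x₀ i ∧ (supp T x₀ y).card = c ∧ Disjoint W (supp T x₀ y) := by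
    intro W c hc
    have h1 : c ≤ (T.erase i \ W).card := by
      have := le_card_sdiff W (T.erase i)
      omega
    obtain ⟨V, hV, hVc⟩ := exists_subset_card_eq h1
    have hVT : V ⊆ T := hV.trans (sdiff_subset.trans (erase_subset _ _))
    refine ⟨vec x₀ alt V, ?_, ?_, ?_⟩
    · unfold vec
      rw [if_neg]
      intro hiV
      exact absurd (mem_sdiff.1 (hV hiV)).1 (notMem_erase _ _)
    · rw [supp_vec halt hVT, hVc]
    · rw [supp_vec halt hVT, disjoint_right]
      intro j hj
      exact (mem_sdiff.1 (hV hj)).2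
  have step : ∀ x x' : ∀ i, Fin (p i), x i = x₀ i → x' i = x₀ i → (supp T x₀ x).card = a →
      (supp T x₀ x').card = a → (supp T x₀ x ∪ supp T x₀ x').card ≤ a + 1 → x ∈ A → x' ∈ A := by
    intro x x' hx hx' hc hc' hu hxA
    obtain ⟨y, hy, hyc, hyd⟩ := hvec (supp T x₀ x ∪ supp T x₀ x') b (by omega)
    rw [disjoint_union_left] at hyd
    have hyB := unshift_disj h hi hm hab hB hx hy hc hyc hyd.1 hxA
    exact unshift_disj h.symm hi hm (by omega) hA hy hx' hyc hc' hyd.2.symm hyB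
  obtain ⟨x, hx, hxc, hxA⟩ := unshift_ex hp hm hA h.neA (h.hvA i hi)
  have hsuppe : ∀ z : ∀ i, Fin (p i), z i = x₀ i → supp T x₀ z ⊆ T.erase i := by
    intro z hz j hj
    rw [mem_supp] at hj
    refine mem_erase.2 ⟨?_, hj.1⟩
    rintro rfl
    exact hj.2 hz
  have hall : ∀ z : ∀ i, Fin (p i), z i = x₀ i → (supp T x₀ z).card = a → z ∈ A := by
    intro z hz hzc
    have := set_connect (S := T.erase i) (a := a)
      (R := fun U => ∃ x : ∀ i, Fin (p i), x i = x₀ i ∧ supp T x₀ x = U ∧ x ∈ A) (by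
        rintro U U' hU hU' hc hc' hu ⟨w, hw, rfl, hwA⟩
        have hU'T : U' ⊆ T := hU'.trans (erase_subset _ _)
        have e : vec x₀ alt U' i = x₀ i := by
          unfold vec
          rw [if_neg (fun hiV => absurd (hU' hiV) (notMem_erase _ _))]
        refine ⟨vec x₀ alt U', e, supp_vec halt hU'T, ?_⟩
        refine step w _ hw e hc ?_ ?_ hwA
        · rw [supp_vec halt hU'T, hc']
        · rwa [supp_vec halt hU'T])
      _ (supp T x₀ x) (supp T x₀ z) (hsuppe x hx) (hsuppe z hz) hxc hzc rfl ⟨x, hx, rfl, hxA⟩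
    obtain ⟨w, hw, hws, hwA⟩ := this
    refine step w z hw hz (by rw [hws, hzc]) hzc ?_ hwA
    rw [hws, union_self]; omega
  refine ⟨unshift_eq hm hA hall cA, unshift_eq hm hB ?_ cB⟩
  intro y hy hyc
  obtain ⟨z, hz, hzc, hzd⟩ := hvec (supp T x₀ y) a (by omega)
  exact unshift_disj h hi hm hab hB hz hy hzc hyc hzd.symm (hall z hz hzc)

lemma stable_of_shift {T : Finset (Fin n)} {x₀ : ∀ i, Fin (p i)} {A : Finset (∀ i, Fin (p i))}
    (h : ∀ i ∈ T, ∀ m, m ≠ x₀ i → shift x₀ i m A = A) :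
    ∀ i ∈ T, ∀ x ∈ A, Function.update x i (x₀ i) ∈ A := by
  intro i hi x hx
  by_cases hxi : x i = x₀ i
  · rw [← hxi, Function.update_eq_self]; exact hx
  · rw [← h i hi (x i) hxi] at hx
    rcases (mem_filter.1 hx).2 with ⟨h, _⟩ | ⟨_, h, h'⟩ | ⟨_, h, _⟩
    · exact absurd h hxi
    · exact h'
    · exact absurd rfl h

lemma structure_ind (hp : ∀ i, 3 ≤ p i) {T : Finset (Fin n)} {s : ℕ} (hs3 : s ≤ 3) (hs1 : 1 ≤ s)
    (hsT : s + 1 ≤ T.card) {x₀ : ∀ i, Fin (p i)} : ∀ (d : ℕ) (A B : Finset (∀ i, Fin (p i))),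
    pot T x₀ A + pot T x₀ B = d → Good T s x₀ A B →
    (∃ a b, a + b = s ∧ A = hBall T x₀ a ∧ B = hBall T x₀ b) ∧ (s + 1 = T.card → False) := by
  intro d
  induction d using Nat.strong_induction_on with
  | _ d ih =>
    intro A B hd h
    by_cases hst : ∀ i ∈ T, ∀ m, m ≠ x₀ i → shift x₀ i m A = A ∧ shift x₀ i m B = B
    · have := h.stable hp hs3 hsT (stable_of_shift fun i hi m hm => (hst i hi m hm).1)
        (stable_of_shift fun i hi m hm => (hst i hi m hm).2)
      exact ⟨this.1, this.2 hs1⟩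
    · push Not at hst
      obtain ⟨i, hi, m, hm, hne⟩ := hst
      obtain ⟨cA, cB⟩ := h.shift_cards hi hm
      have hlt : pot T x₀ (shift x₀ i m A) + pot T x₀ (shift x₀ i m B) < d := by
        have h1 := pot_le (T := T) hm cA
        have h2 := pot_le (T := T) hm cB
        by_cases hA : shift x₀ i m A = A
        · have := pot_lt hi hm cB (hne hA)
          omega
        · have := pot_lt hi hm cA hA
          omega
      obtain ⟨⟨a, b, hab, hA, hB⟩, hF⟩ := ih _ hlt _ _ rfl (h.shift hi hm)
      by_cases hs : s + 1 = T.card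
      · exact (hF hs).elim
      · have := unshift hp h hi hm hab (by omega) hA hB
        exact absurd this.2 (hne this.1)

theorem structure_thm (hp : ∀ i, 3 ≤ p i) {T : Finset (Fin n)} {s : ℕ} (hs3 : s ≤ 3)
    (hsT : s + 1 ≤ T.card) {x₀ : ∀ i, Fin (p i)} {A B : Finset (∀ i, Fin (p i))}
    (h : Good T s x₀ A B) :
    ∃ (x₁ : ∀ i, Fin (p i)) (a b : ℕ), A = hBall T x₁ a ∧ B = hBall T x₁ b := by
  rcases Nat.eq_zero_or_pos s with rfl | hs
  · obtain ⟨x, hx⟩ := h.neA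
    obtain ⟨y, hy⟩ := h.neB
    have e : ∀ u v : ∀ i, Fin (p i), dT T u v ≤ 0 ↔ ∀ i ∈ T, u i = v i := by
      intro u v
      unfold dT
      rw [Nat.le_zero, card_eq_zero, filter_eq_empty_iff]
      simp
    have hb : ∀ u v : ∀ i, Fin (p i), u ∈ hBall T v 0 ↔ ∀ i ∈ T, u i = v i := by
      intro u v
      rw [← e]
      simp [hBall, dT]
    have hxy := (e x y).1 (h.cross x hx y hy)
    refine ⟨x, 0, 0, ?_, ?_⟩
    · ext z
      rw [hb]
      constructor
      · intro hz i hi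
        rw [(e z y).1 (h.cross z hz y hy) i hi, hxy i hi]
      · intro hz
        rw [h.mem_iff]
        intro w hw
        rw [e]
        intro i hi
        rw [hz i hi, (e x w).1 (h.cross x hx w hw) i hi]
    · ext z
      rw [hb]
      constructor
      · intro hz i hi
        rw [(e x z).1 (h.cross x hx z hz) i hi]
      · intro hz
        rw [h.symm.mem_iff]
        intro w hw
        rw [e]
        intro i hi
        rw [hz i hi, hxy i hi, (e w y).1 (h.cross w hw y hy) i hi]
  · obtain ⟨⟨a, b, _, hA, hB⟩, _⟩ := structure_ind hp hs3 hs hsT _ A B rfl h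
    exact ⟨x₀, a, b, hA, hB⟩
end vec3


section vec4
variable {n : ℕ} {p : Fin n → ℕ}

lemma CrossInt.symm {r : ℕ} {A B : Finset (∀ i, Fin (p i))} (h : CrossInt r A B) :
    CrossInt r B A := by
  intro x hx y hy
  have := h y hy x hx
  simpa [eq_comm] using this

lemma MaxPair.symm {r : ℕ} {A B : Finset (∀ i, Fin (p i))} (h : MaxPair r A B) :
    MaxPair r B A := by
  refine ⟨h.1.symm, fun A' B' hc => ?_⟩
  rw [mul_comm, mul_comm B.card]
  exact h.2 _ _ hc.symm

lemma MaxPair.pos (hp : ∀ i, 3 ≤ p i) {r : ℕ} (hrn : r ≤ n) {A B : Finset (∀ i, Fin (p i))}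
    (h : MaxPair r A B) : 0 < A.card ∧ 0 < B.card := by
  have hz : ∀ i, 0 < p i := fun i => by have := hp i; omega
  have h1 := h.2 {fun i => ⟨0, hz i⟩} {fun i => ⟨0, hz i⟩} (by
    intro x hx y hy
    rw [mem_singleton] at hx hy
    subst hx; subst hy
    simpa using hrn)
  rw [card_singleton] at h1
  exact ⟨Nat.pos_of_ne_zero (by rintro h0; simp [h0] at h1),
    Nat.pos_of_ne_zero (by rintro h0; simp [h0] at h1)⟩

/-- cylinder over a union of sections -/
def cyl (i : Fin n) (L : Finset (Fin (p i))) (A : Finset (∀ i, Fin (p i))) :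
    Finset (∀ i, Fin (p i)) :=
  univ.filter (fun x => ∃ l ∈ L, Function.update x i l ∈ A)

lemma cyl_cross {r : ℕ} {A B : Finset (∀ i, Fin (p i))} (h : CrossInt r A B) {i : Fin n}
    {L M : Finset (Fin (p i))} (hLM : Disjoint L M) : CrossInt r (cyl i L A) (cyl i M B) := by
  intro x hx y hy
  obtain ⟨l, hl, hx⟩ := (mem_filter.1 hx).2
  obtain ⟨m, hm, hy⟩ := (mem_filter.1 hy).2
  refine (h _ hx _ hy).trans (card_le_card ?_)
  intro j hj
  rw [mem_filter] at hj ⊢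
  refine ⟨mem_univ _, ?_⟩
  have hj := hj.2
  by_cases hji : j = i
  · subst hji
    rw [Function.update_self, Function.update_self] at hj
    subst hj
    exact absurd hm (disjoint_left.1 hLM hl)
  · rwa [Function.update_of_ne hji, Function.update_of_ne hji] at hj

lemma cyl_card (i : Fin n) (l : Fin (p i)) (A : Finset (∀ i, Fin (p i))) :
    (cyl i {l} A).card = p i * (A.filter (fun x => x i = l)).card := by
  rw [card_eq_sum_card_fiberwise (f := fun x : ∀ i, Fin (p i) => x i) (t := univ)
    (fun _ _ => mem_coe.2 (mem_univ _))]
  rw [sum_congr rfl (g := fun _ => (A.filter (fun x => x i = l)).card)]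
  · simp
  intro c _
  refine card_nbij' (fun x => Function.update x i l) (fun x => Function.update x i c) ?_ ?_ ?_ ?_
  · intro x hx
    obtain ⟨hx, _⟩ := mem_filter.1 hx
    obtain ⟨l', hl', hx'⟩ := (mem_filter.1 hx).2
    rw [mem_singleton] at hl'
    subst hl'
    exact mem_coe.2 (mem_filter.2 ⟨hx', by simp⟩)
  · intro x hx
    obtain ⟨hx, h2⟩ := mem_filter.1 hx
    refine mem_coe.2 (mem_filter.2 ⟨mem_filter.2 ⟨mem_univ _, l, mem_singleton_self _, ?_⟩, by simp⟩)
    rw [Function.update_idem, ← h2, Function.update_eq_self]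
    exact hx
  · intro x hx
    obtain ⟨hx, h2⟩ := mem_filter.1 hx
    simp only [Function.update_idem]
    rw [← h2, Function.update_eq_self]
  · intro x hx
    obtain ⟨hx, h2⟩ := mem_filter.1 hx
    simp only [Function.update_idem]
    rw [← h2, Function.update_eq_self]

lemma not_relevant {A : Finset (∀ i, Fin (p i))} {i : Fin n} :
    ¬ Relevant A i ↔ ∀ x ∈ A, ∀ c, Function.update x i c ∈ A := by
  constructor
  · intro h x hx c
    by_contra hc
    exact h ⟨x, Function.update x i c, fun j hj => (Function.update_of_ne hj _ _).symm, hx, hc⟩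
  · rintro h ⟨x, y, hxy, hx, hy⟩
    apply hy
    have : y = Function.update x i (y i) := by
      funext j
      by_cases hj : j = i
      · subst hj; simp
      · rw [Function.update_of_ne hj, hxy j hj]
    rw [this]
    exact h x hx _

/-- equal sections force irrelevance -/
lemma equal_sections {r : ℕ} {A B : Finset (∀ i, Fin (p i))} (h : MaxPair r A B)
    (hB0 : 0 < B.card) {i : Fin n} (hpi : 3 ≤ p i)
    (hA : ∀ l, p i * (A.filter (fun x => x i = l)).card = A.card)
    (hB : ∀ l, p i * (B.filter (fun x => x i = l)).card = B.card) : ¬ Relevant A i := by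
  have key : ∀ l l' : Fin (p i), cyl i {l} A = cyl i {l, l'} A := by
    intro l l'
    obtain ⟨m, hm⟩ : ∃ m : Fin (p i), m ∉ ({l, l'} : Finset (Fin (p i))) := by
      by_contra hcon
      push Not at hcon
      have h1 : (univ : Finset (Fin (p i))).card ≤ ({l, l'} : Finset (Fin (p i))).card :=
        card_le_card fun m _ => hcon m
      have h2 := card_le_two (a := l) (b := l')
      rw [card_univ, Fintype.card_fin] at h1
      omega
    have h1 := h.2 _ _ (cyl_cross h.1 (disjoint_singleton_right.2 hm))
    rw [cyl_card i m B, hB m] at h1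
    have h2 := Nat.le_of_mul_le_mul_right h1 hB0
    refine eq_of_subset_of_card_le ?_ (by rw [cyl_card, hA]; exact h2)
    intro x hx
    obtain ⟨l'', hl'', hx⟩ := (mem_filter.1 hx).2
    exact mem_filter.2 ⟨mem_univ _, l'', by simp at hl''; simp [hl''], hx⟩
  rw [not_relevant]
  intro x hx c
  have h1 : x ∈ cyl i {x i} A := mem_filter.2 ⟨mem_univ _, x i, by simp, by
    rw [Function.update_eq_self]; exact hx⟩
  rw [key (x i) c, pair_comm, ← key c (x i)] at h1
  obtain ⟨l, hl, hx⟩ := (mem_filter.1 h1).2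
  rw [mem_singleton] at hl
  rwa [← hl]

lemma sum_sections (i : Fin n) (A : Finset (∀ i, Fin (p i))) :
    ∑ l, (A.filter (fun x => x i = l)).card = A.card :=
  (card_eq_sum_card_fiberwise (f := fun x : ∀ i, Fin (p i) => x i) (t := univ)
    (fun _ _ => mem_coe.2 (mem_univ _))).symm

lemma heavy_real {P α β : ℝ} (hP : 3 ≤ P) (hα : 1 / P < α) (hαβ : α ≤ β) (hβ1 : α ≤ 1)
    (h : P ^ 2 * (β * (1 - α)) ≤ P - 1) : P * (1 - α) ≤ 1 ∧ P * (1 - β) ≤ 1 := by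
  have h0 : 1 < P * α := by
    rw [div_lt_iff₀ (by linarith)] at hα; linarith
  have h1 : P ^ 2 * (α * (1 - α)) ≤ P - 1 := by
    refine le_trans ?_ h
    have : α * (1 - α) ≤ β * (1 - α) := mul_le_mul_of_nonneg_right hαβ (by linarith)
    exact mul_le_mul_of_nonneg_left this (by positivity)
  have h2 : 0 ≤ (P * α - 1) * (P * α - (P - 1)) := by nlinarith
  have h3 : 0 ≤ P * α - (P - 1) := by
    by_contra hc
    push Not at hc
    nlinarith
  constructor
  · linarith
  · nlinarith

lemma heavy_coord_aux {r : ℕ} {A B : Finset (∀ i, Fin (p i))}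
    (h : MaxPair r A B) (hA0 : 0 < A.card) (hB0 : 0 < B.card) {i : Fin n} (hpi : 3 ≤ p i)
    {l : Fin (p i)} (hl : A.card < p i * (A.filter (fun x => x i = l)).card) :
    p i * (A.filter (fun x => x i ≠ l)).card ≤ A.card ∧
      p i * (B.filter (fun x => x i ≠ l)).card ≤ B.card := by
  have H1 : ∀ l m : Fin (p i), l ≠ m → p i * (A.filter (fun x => x i = l)).card *
      (p i * (B.filter (fun x => x i = m)).card) ≤ A.card * B.card := by
    intro l m hlm
    have := h.2 _ _ (cyl_cross h.1 (disjoint_singleton_right.2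
      (by simpa using hlm.symm : m ∉ ({l} : Finset (Fin (p i))))))
    rwa [cyl_card, cyl_card] at this
  have sA := sum_sections i A
  have sB := sum_sections i B
  have cA := card_filter_add_card_filter_not (s := A) (fun x => x i = l)
  have cB := card_filter_add_card_filter_not (s := B) (fun x => x i = l)
  simp only [ne_eq]
  set a : Fin (p i) → ℕ := fun l => (A.filter (fun x => x i = l)).card with ha
  set b : Fin (p i) → ℕ := fun l => (B.filter (fun x => x i = l)).card with hb
  change ∑ l, a l = _ at sA
  change ∑ l, b l = _ at sB
  change ∀ l m : Fin (p i), l ≠ m → p i * a l * (p i * b m) ≤ A.card * B.card at H1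
  change A.card < p i * a l at hl
  change a l + _ = _ at cA
  change b l + _ = _ at cB
  clear_value a b
  have hbm : ∀ m, m ≠ l → p i * b m < B.card := by
    intro m hm
    have := H1 l m hm.symm
    by_contra hc
    push Not at hc
    have : A.card * B.card < p i * a l * (p i * b m) :=
      Nat.mul_lt_mul_of_lt_of_le hl hc (hB0.trans_le hc)
    omega
  have hcard : (univ.erase l).card = p i - 1 := by
    rw [card_erase_of_mem (mem_univ _), card_univ, Fintype.card_fin]
  have hsplitA : a l + ∑ m ∈ univ.erase l, a m = A.card := by
    rw [add_sum_erase _ _ (mem_univ l), sA]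
  have hsplitB : b l + ∑ m ∈ univ.erase l, b m = B.card := by
    rw [add_sum_erase _ _ (mem_univ l), sB]
  have hbl : B.card < p i * b l := by
    have h1 : ∑ m ∈ univ.erase l, p i * b m < ∑ m ∈ univ.erase l, B.card :=
      sum_lt_sum_of_nonempty (card_pos.1 (by omega)) fun m hm => hbm m (ne_of_mem_erase hm)
    rw [← mul_sum, sum_const, hcard, smul_eq_mul] at h1
    have h2 : p i * b l + p i * ∑ m ∈ univ.erase l, b m = p i * B.card := by
      rw [← mul_add, hsplitB]
    have h3 : p i * B.card = (p i - 1) * B.card + B.card := by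
      obtain ⟨q, hq⟩ : ∃ q, p i = q + 1 := ⟨p i - 1, by omega⟩
      rw [hq, Nat.add_sub_cancel]; ring
    omega
  have E1 : p i * a l * (p i * ∑ m ∈ univ.erase l, b m) ≤ (p i - 1) * (A.card * B.card) := by
    rw [← hcard, ← smul_eq_mul ((univ.erase l).card), ← sum_const, mul_sum, mul_sum]
    exact sum_le_sum fun m hm => H1 l m (ne_of_mem_erase hm).symm
  have E2 : p i * b l * (p i * ∑ m ∈ univ.erase l, a m) ≤ (p i - 1) * (A.card * B.card) := by
    rw [← hcard, ← smul_eq_mul ((univ.erase l).card), ← sum_const, mul_sum, mul_sum]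
    refine sum_le_sum fun m hm => ?_
    rw [mul_comm]
    exact H1 m l (ne_of_mem_erase hm)
  set a' := ∑ m ∈ univ.erase l, a m
  set b' := ∑ m ∈ univ.erase l, b m
  have ea : (A.filter (fun x => ¬ x i = l)).card = a' := by omega
  have eb : (B.filter (fun x => ¬ x i = l)).card = b' := by omega
  rw [ea, eb]
  clear_value a' b'
  generalize A.card = NA at *
  generalize B.card = NB at *
  generalize a l = al at *
  generalize b l = bl at *
  have hP : (3 : ℝ) ≤ (p i : ℝ) := by exact_mod_cast hpi
  have hNA : (0 : ℝ) < NA := by exact_mod_cast hA0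
  have hNB : (0 : ℝ) < NB := by exact_mod_cast hB0
  have e1 : (al : ℝ) + a' = NA := by exact_mod_cast hsplitA
  have e2 : (bl : ℝ) + b' = NB := by exact_mod_cast hsplitB
  have f1 : (NA : ℝ) < p i * al := by exact_mod_cast hl
  have f2 : (NB : ℝ) < p i * bl := by exact_mod_cast hbl
  have g1 : (p i : ℝ) * al * (p i * b') ≤ (p i - 1) * (NA * NB) := by
    have : ((p i * al * (p i * b') : ℕ) : ℝ) ≤ (((p i - 1) * (NA * NB) : ℕ) : ℝ) := by
      exact_mod_cast E1
    rw [Nat.cast_mul (p i - 1), Nat.cast_sub (by omega)] at this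
    push_cast at this
    exact this
  have g2 : (p i : ℝ) * bl * (p i * a') ≤ (p i - 1) * (NA * NB) := by
    have : ((p i * bl * (p i * a') : ℕ) : ℝ) ≤ (((p i - 1) * (NA * NB) : ℕ) : ℝ) := by
      exact_mod_cast E2
    rw [Nat.cast_mul (p i - 1), Nat.cast_sub (by omega)] at this
    push_cast at this
    exact this
  have ha0 : (0 : ℝ) ≤ a' := Nat.cast_nonneg _
  have hb0 : (0 : ℝ) ≤ b' := Nat.cast_nonneg _
  have k1 : 1 / (p i : ℝ) < al / NA := by
    rw [div_lt_div_iff₀ (by linarith) hNA]; linarith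
  have k2 : 1 / (p i : ℝ) < bl / NB := by
    rw [div_lt_div_iff₀ (by linarith) hNB]; linarith
  have l1 : 1 - (al : ℝ) / NA = a' / NA := by field_simp; linarith
  have l2 : 1 - (bl : ℝ) / NB = b' / NB := by field_simp; linarith
  have m1 : (p i : ℝ) ^ 2 * (al / NA * (1 - bl / NB)) ≤ p i - 1 := by
    rw [l2, show (p i : ℝ) ^ 2 * (al / NA * (b' / NB)) = (p i * al * (p i * b')) / (NA * NB) by
      field_simp, div_le_iff₀ (by positivity)]
    exact g1
  have m2 : (p i : ℝ) ^ 2 * (bl / NB * (1 - al / NA)) ≤ p i - 1 := by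
    rw [l1, show (p i : ℝ) ^ 2 * (bl / NB * (a' / NA)) = (p i * bl * (p i * a')) / (NA * NB) by
      field_simp, div_le_iff₀ (by positivity)]
    exact g2
  have o1 : (al : ℝ) / NA ≤ 1 := by
    have : 0 ≤ (a' : ℝ) / NA := by positivity
    linarith
  have o2 : (bl : ℝ) / NB ≤ 1 := by
    have : 0 ≤ (b' : ℝ) / NB := by positivity
    linarith
  have fin : (p i : ℝ) * (1 - al / NA) ≤ 1 ∧ (p i : ℝ) * (1 - bl / NB) ≤ 1 := by
    rcases le_total ((al : ℝ) / NA) (bl / NB) with hle | hle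
    · exact heavy_real hP k1 hle o1 m2
    · exact (heavy_real hP k2 hle o2 m1).symm
  rw [l1, l2, ← mul_div_assoc, ← mul_div_assoc, div_le_one hNA, div_le_one hNB] at fin
  exact ⟨by exact_mod_cast fin.1, by exact_mod_cast fin.2⟩

lemma heavy_coord {r : ℕ} {A B : Finset (∀ i, Fin (p i))}
    (h : MaxPair r A B) (hA0 : 0 < A.card) (hB0 : 0 < B.card) {i : Fin n} (hpi : 3 ≤ p i)
    (hrel : Relevant A i ∨ Relevant B i) :
    ∃ l, p i * (A.filter (fun x => x i ≠ l)).card ≤ A.card ∧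
      p i * (B.filter (fun x => x i ≠ l)).card ≤ B.card := by
  by_cases h1 : ∃ l, A.card < p i * (A.filter (fun x => x i = l)).card
  · obtain ⟨l, hl⟩ := h1
    exact ⟨l, heavy_coord_aux h hA0 hB0 hpi hl⟩
  by_cases h2 : ∃ l, B.card < p i * (B.filter (fun x => x i = l)).card
  · obtain ⟨l, hl⟩ := h2
    exact ⟨l, (heavy_coord_aux h.symm hB0 hA0 hpi hl).symm⟩
  exfalso
  push Not at h1 h2
  have eqs : ∀ A : Finset (∀ i, Fin (p i)),
      (∀ l, p i * (A.filter (fun x => x i = l)).card ≤ A.card) →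
      ∀ l, p i * (A.filter (fun x => x i = l)).card = A.card := by
    intro A hA l
    have h3 : ∑ l : Fin (p i), p i * (A.filter (fun x => x i = l)).card =
        ∑ l : Fin (p i), A.card := by
      rw [← mul_sum, sum_sections]; simp
    exact (sum_eq_sum_iff_of_le (fun l _ => hA l)).1 h3 l (mem_univ _)
  rcases hrel with hr | hr
  · exact equal_sections h hB0 hpi (eqs A h1) (eqs B h2) hr
  · exact equal_sections h.symm hA0 hpi (eqs B h2) (eqs A h1) hr

lemma agree_T (hp : ∀ i, 3 ≤ p i) {r : ℕ} {A B : Finset (∀ i, Fin (p i))} (h : MaxPair r A B)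
    {T : Finset (Fin n)} (hT : ∀ i, i ∉ T → ¬ Relevant B i) {x y : ∀ i, Fin (p i)}
    (hx : x ∈ A) (hy : y ∈ B) : r ≤ (T.filter (fun i => x i = y i)).card := by
  obtain ⟨alt, halt⟩ := exists_alt hp x
  have hy' : (Tᶜ).piecewise alt y ∈ B := by
    refine down_piecewise (T := Tᶜ) (fun i hi z hz => ?_) hy _ Subset.rfl
    exact not_relevant.1 (hT i (mem_compl.1 hi)) z hz _
  refine (h.1 x hx _ hy').trans (card_le_card ?_)
  intro i hi
  have hi := (mem_filter.1 hi).2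
  by_cases hiT : i ∈ T
  · rw [piecewise_eq_of_notMem _ _ _ (by simpa using hiT)] at hi
    exact mem_filter.2 ⟨hiT, hi⟩
  · rw [piecewise_eq_of_mem _ _ _ (by simpa using hiT)] at hi
    exact absurd hi.symm (halt i)

lemma good_of_maxPair (hp : ∀ i, 3 ≤ p i) {r : ℕ} (hrn : r ≤ n) {A B : Finset (∀ i, Fin (p i))}
    (h : MaxPair r A B) {T : Finset (Fin n)} (hT : ∀ i, i ∈ T ↔ Relevant A i ∨ Relevant B i) :
    r ≤ T.card ∧ ∃ x₀, Good T (T.card - r) x₀ A B := by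
  obtain ⟨hA0, hB0⟩ := h.pos hp hrn
  have hBT : ∀ i, i ∉ T → ¬ Relevant B i := fun i hi hr => hi ((hT i).2 (Or.inr hr))
  have hrT : r ≤ T.card := by
    obtain ⟨x, hx⟩ := card_pos.1 hA0
    obtain ⟨y, hy⟩ := card_pos.1 hB0
    exact (agree_T hp h hBT hx hy).trans (card_le_card (filter_subset _ _))
  refine ⟨hrT, ?_⟩
  have hex : ∀ i, ∃ l : Fin (p i), i ∈ T → p i * (A.filter (fun x => x i ≠ l)).card ≤ A.card ∧
      p i * (B.filter (fun x => x i ≠ l)).card ≤ B.card := by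
    intro i
    by_cases hi : i ∈ T
    · obtain ⟨l, hl⟩ := heavy_coord h hA0 hB0 (hp i) ((hT i).1 hi)
      exact ⟨l, fun _ => hl⟩
    · exact ⟨⟨0, by have := hp i; omega⟩, fun h => absurd h hi⟩
  choose x₀ hx₀ using hex
  have hsum : ∀ x y : ∀ i, Fin (p i), (T.filter (fun i => x i = y i)).card + dT T x y = T.card :=
    fun x y => card_filter_add_card_filter_not _
  refine ⟨x₀, ?_, ?_, card_pos.1 hA0, card_pos.1 hB0, fun i hi => (hx₀ i hi).1,
    fun i hi => (hx₀ i hi).2⟩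
  · intro x hx y hy
    have := agree_T hp h hBT hx hy
    have := hsum x y
    omega
  · intro A' B' hc
    refine h.2 A' B' fun x hx y hy => ?_
    have h1 := hc x hx y hy
    have h2 := hsum x y
    have h3 : (T.filter (fun i => x i = y i)).card ≤ (univ.filter (fun i => x i = y i)).card :=
      card_le_card (filter_subset_filter _ (subset_univ _))
    omega
end vec4


section vec5
variable {n : ℕ} {p : Fin n → ℕ}

lemma log_step {p : ℕ} (hp : 3 ≤ p) :
    Real.log ((p : ℝ) - 1) * Real.log ((p : ℝ) + 1) ≤ Real.log p ^ 2 := by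
  have h3 : (3 : ℝ) ≤ p := by exact_mod_cast hp
  have h1 : 0 ≤ Real.log ((p : ℝ) - 1) := Real.log_nonneg (by linarith)
  have h2 : 0 ≤ Real.log ((p : ℝ) + 1) := Real.log_nonneg (by linarith)
  have h4 : Real.log ((p : ℝ) - 1) + Real.log ((p : ℝ) + 1) ≤ 2 * Real.log p := by
    rw [← Real.log_mul (by linarith) (by linarith)]
    calc _ ≤ Real.log ((p : ℝ) ^ 2) := Real.log_le_log (by nlinarith) (by nlinarith)
      _ = _ := by rw [Real.log_pow]; norm_num
  have h5 : 0 ≤ Real.log (p : ℝ) := Real.log_nonneg (by linarith)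
  nlinarith [sq_nonneg (Real.log ((p : ℝ) - 1) - Real.log ((p : ℝ) + 1))]

lemma log_ratio {k p : ℕ} (hk : 3 ≤ k) (hkp : k ≤ p) :
    Real.log p * Real.log ((k : ℝ) - 1) ≤ Real.log k * Real.log ((p : ℝ) - 1) := by
  induction p, hkp using Nat.le_induction with
  | base => exact le_refl _
  | succ p hkp ih =>
    have h3 : (3 : ℝ) ≤ p := by exact_mod_cast hk.trans hkp
    have h4 : (3 : ℝ) ≤ k := by exact_mod_cast hk
    have h1 := log_step (hk.trans hkp)
    have hp0 : 0 < Real.log (p : ℝ) := Real.log_pos (by linarith)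
    have hk0 : 0 < Real.log (k : ℝ) := Real.log_pos (by linarith)
    have h2 : 0 < Real.log ((p : ℝ) + 1) := Real.log_pos (by linarith)
    push_cast
    rw [add_sub_cancel_right]
    refine le_of_mul_le_mul_left ?_ hp0
    calc Real.log p * (Real.log ((p : ℝ) + 1) * Real.log ((k : ℝ) - 1))
        = Real.log ((p : ℝ) + 1) * (Real.log p * Real.log ((k : ℝ) - 1)) := by ring
      _ ≤ Real.log ((p : ℝ) + 1) * (Real.log k * Real.log ((p : ℝ) - 1)) :=
          mul_le_mul_of_nonneg_left ih h2.le
      _ = Real.log k * (Real.log ((p : ℝ) - 1) * Real.log ((p : ℝ) + 1)) := by ring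
      _ ≤ Real.log k * Real.log p ^ 2 := mul_le_mul_of_nonneg_left h1 hk0.le
      _ = _ := by ring

lemma f_ratio {k p : ℕ} (hk : 3 ≤ k) (hkp : k ≤ p) :
    Real.log p * ((1 - 2 / (k : ℝ)) * Real.log ((k : ℝ) - 1)) ≤
      Real.log k * ((1 - 2 / (p : ℝ)) * Real.log ((p : ℝ) - 1)) := by
  have h4 : (3 : ℝ) ≤ k := by exact_mod_cast hk
  have h3 : (k : ℝ) ≤ p := by exact_mod_cast hkp
  have h1 : 2 / (p : ℝ) ≤ 2 / k := div_le_div_of_nonneg_left (by norm_num) (by linarith) h3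
  have h2 : 2 / (k : ℝ) ≤ 1 := by rw [div_le_one (by linarith)]; linarith
  have h5 := log_ratio hk hkp
  have h6 : 0 ≤ Real.log p * Real.log ((k : ℝ) - 1) :=
    mul_nonneg (Real.log_nonneg (by linarith)) (Real.log_nonneg (by linarith))
  calc _ = (1 - 2 / (k : ℝ)) * (Real.log p * Real.log ((k : ℝ) - 1)) := by ring
    _ ≤ (1 - 2 / (p : ℝ)) * (Real.log k * Real.log ((p : ℝ) - 1)) :=
      mul_le_mul (by linarith) h5 h6 (by linarith)
    _ = _ := by ring

lemma exists_light {ι : Type*} [DecidableEq ι] (g : ι → ℝ) (r : ℕ) :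
    ∀ (d : ℕ) (T : Finset ι), T.card = r + d →
      ∃ R, R ⊆ T ∧ R.card = r ∧ (T.card : ℝ) * ∑ i ∈ R, g i ≤ r * ∑ i ∈ T, g i := by
  intro d
  induction d with
  | zero =>
    intro T hT
    exact ⟨T, Subset.rfl, by omega, by rw [hT]; simp⟩
  | succ d ih =>
    intro T hT
    obtain ⟨j, hj, hmax⟩ := exists_max_image T g (card_pos.1 (by omega))
    have hc := card_erase_of_mem hj
    obtain ⟨R, hR, hRc, hle⟩ := ih (T.erase j) (by omega)
    refine ⟨R, hR.trans (erase_subset _ _), hRc, ?_⟩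
    have h1 : ∑ i ∈ R, g i ≤ r * g j := by
      rw [← hRc, ← nsmul_eq_mul]
      exact sum_le_card_nsmul _ _ _ fun i hi => hmax i (mem_of_mem_erase (hR hi))
    rw [← add_sum_erase _ _ hj]
    have h2 : (T.card : ℝ) = (T.erase j).card + 1 := by
      rw [hc, hT]; push_cast [Nat.add_sub_cancel]; simp; ring
    rw [h2]
    linarith

lemma log_card_bound (hp : ∀ i, 3 ≤ p i) {T : Finset (Fin n)} {x₀ : ∀ i, Fin (p i)}
    {A : Finset (∀ i, Fin (p i))} (hne : A.Nonempty)
    (hv : ∀ i ∈ T, p i * (A.filter (fun x => x i ≠ x₀ i)).card ≤ A.card) :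
    Real.log A.card ≤ ∑ i, Real.log (p i) -
      ∑ i ∈ T, (1 - 2 / (p i : ℝ)) * Real.log ((p i : ℝ) - 1) := by
  have hp' : ∀ i, (3 : ℝ) ≤ p i := fun i => by exact_mod_cast hp i
  set w : ∀ i, Fin (p i) → ℝ := fun i c =>
    if i ∈ T then (if c = x₀ i then ((p i : ℝ) - 1) / p i else 1 / (p i * ((p i : ℝ) - 1)))
    else 1 / p i with hw
  have hwpos : ∀ i c, 0 < w i c := by
    intro i c
    have := hp' i
    have h1 : (0 : ℝ) < p i := by linarith
    have h2 : (0 : ℝ) < (p i : ℝ) - 1 := by linarith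
    simp only [hw]
    split_ifs <;> positivity
  have hwsum : ∀ i, ∑ c, w i c = 1 := by
    intro i
    have := hp' i
    have h1 : (p i : ℝ) ≠ 0 := by linarith
    have h2 : (p i : ℝ) - 1 ≠ 0 := by linarith
    simp only [hw]
    by_cases hi : i ∈ T
    · simp only [hi, if_true]
      rw [← add_sum_erase _ _ (mem_univ (x₀ i)), if_pos rfl,
        sum_congr rfl (g := fun _ => 1 / ((p i : ℝ) * ((p i : ℝ) - 1)))
          (fun c hc => if_neg (ne_of_mem_erase hc)), sum_const,
        card_erase_of_mem (mem_univ _), card_univ, Fintype.card_fin, nsmul_eq_mul,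
        Nat.cast_sub (by have := hp i; omega)]
      push_cast
      field_simp
      ring
    · simp only [hi, if_false]
      simp [h1]
  have hQ : ∑ x : ∀ i, Fin (p i), ∏ i, w i (x i) = 1 := by
    have := prod_univ_sum (fun i => (univ : Finset (Fin (p i)))) w
    rw [Fintype.piFinset_univ] at this
    rw [← this]
    exact prod_eq_one fun i _ => hwsum i
  have hN : (0 : ℝ) < A.card := by exact_mod_cast card_pos.2 hne
  have hQA : ∑ x ∈ A, ∏ i, w i (x i) ≤ 1 := by
    rw [← hQ]
    exact sum_le_sum_of_subset_of_nonneg (subset_univ _)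
      fun x _ _ => prod_nonneg fun i _ => (hwpos i _).le
  have h1 : ∑ x ∈ A, (Real.log A.card + ∑ i, Real.log (w i (x i))) ≤ 0 := by
    calc _ ≤ ∑ x ∈ A, ((A.card : ℝ) * ∏ i, w i (x i) - 1) := by
          refine sum_le_sum fun x _ => ?_
          rw [← Real.log_prod (fun i _ => (hwpos i _).ne'),
            ← Real.log_mul hN.ne' (prod_pos fun i _ => hwpos i _).ne']
          exact Real.log_le_sub_one_of_pos (mul_pos hN (prod_pos fun i _ => hwpos i _))
      _ = A.card * ∑ x ∈ A, ∏ i, w i (x i) - A.card := by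
          rw [sum_sub_distrib, mul_sum]; simp
      _ ≤ 0 := by nlinarith
  rw [sum_add_distrib, sum_const, nsmul_eq_mul, sum_comm] at h1
  have h2 : ∀ i, (A.card : ℝ) * (-Real.log (p i) +
      if i ∈ T then (1 - 2 / (p i : ℝ)) * Real.log ((p i : ℝ) - 1) else 0) ≤
      ∑ x ∈ A, Real.log (w i (x i)) := by
    intro i
    have h3 := hp' i
    have h1 : (p i : ℝ) ≠ 0 := by linarith
    have h2 : (p i : ℝ) - 1 ≠ 0 := by linarith
    by_cases hi : i ∈ T
    · simp only [hw, hi, if_true]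
      have e : ∀ x : ∀ i, Fin (p i), Real.log (if x i = x₀ i then ((p i : ℝ) - 1) / p i
          else 1 / (p i * ((p i : ℝ) - 1))) = -Real.log (p i) + Real.log ((p i : ℝ) - 1) -
          2 * Real.log ((p i : ℝ) - 1) * (if x i ≠ x₀ i then 1 else 0) := by
        intro x
        by_cases hx : x i = x₀ i
        · simp only [hx, if_true, ne_eq, not_true, if_false]
          rw [Real.log_div h2 h1]; ring
        · simp only [hx, if_false, ne_eq, not_false_iff, if_true]
          rw [one_div, Real.log_inv, Real.log_mul h1 h2]; ring
      rw [sum_congr rfl (fun x _ => e x), sum_sub_distrib, sum_const, nsmul_eq_mul, ← mul_sum,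
        sum_boole]
      have hl : 0 ≤ Real.log ((p i : ℝ) - 1) := Real.log_nonneg (by linarith)
      have hv' : ((A.filter (fun x => x i ≠ x₀ i)).card : ℝ) ≤ A.card / p i := by
        rw [le_div_iff₀ (by linarith)]
        have := hv i hi
        rw [mul_comm] at this
        exact_mod_cast this
      have := mul_le_mul_of_nonneg_left hv' hl
      have e2 : (A.card : ℝ) * (-Real.log (p i) + (1 - 2 / (p i : ℝ)) * Real.log ((p i : ℝ) - 1)) =
        A.card * (-Real.log (p i) + Real.log ((p i : ℝ) - 1)) -
          2 * (Real.log ((p i : ℝ) - 1) * (A.card / p i)) := by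
        field_simp
        ring
      rw [e2]
      linarith
    · simp only [hw, hi, if_false, add_zero, sum_const, nsmul_eq_mul]
      rw [one_div, Real.log_inv]
  have h3 := sum_le_sum (s := univ) fun i _ => h2 i
  rw [← mul_sum, sum_add_distrib, sum_neg_distrib, sum_ite_mem, univ_inter] at h3
  have h4 : (A.card : ℝ) * (Real.log A.card + (-∑ i, Real.log (p i) +
    ∑ i ∈ T, (1 - 2 / (p i : ℝ)) * Real.log ((p i : ℝ) - 1))) ≤ 0 := by
    rw [mul_add]; linarith
  have h5 := nonpos_of_mul_nonpos_right h4 hN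
  linarith

lemma count_bound (hp : ∀ i, 3 ≤ p i) {r : ℕ} (hr : 1 ≤ r)
    {k : ℕ} (hk3 : 3 ≤ k) (hk' : ∀ i, k ≤ p i) {A B : Finset (∀ i, Fin (p i))}
    (h : MaxPair r A B) {T : Finset (Fin n)} (hrT : r ≤ T.card) {s : ℕ} {x₀ : ∀ i, Fin (p i)}
    (hG : Good T s x₀ A B) :
    (T.card : ℝ) * ((1 - 2 / (k : ℝ)) * Real.log ((k : ℝ) - 1)) ≤ r * Real.log k := by
  have hp' : ∀ i, (3 : ℝ) ≤ p i := fun i => by exact_mod_cast hp i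
  have hA := log_card_bound hp hG.neA hG.hvA
  have hB := log_card_bound hp hG.neB hG.hvB
  obtain ⟨R, hRT, hRc, hR⟩ := exists_light (fun i => Real.log (p i)) r (T.card - r) T (by omega)
  have hcard := card_fiber (p := p) (T := R) (x₀ := x₀) (empty_subset R)
  rw [prod_empty, mul_one] at hcard
  have hm := h.2 (univ.filter (fun x : ∀ i, Fin (p i) => supp R x₀ x = ∅))
    (univ.filter (fun x : ∀ i, Fin (p i) => supp R x₀ x = ∅)) (by
      intro x hx y hy
      have hx := (mem_filter.1 hx).2
      have hy := (mem_filter.1 hy).2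
      rw [← hRc]
      refine card_le_card fun i hi => mem_filter.2 ⟨mem_univ _, ?_⟩
      have h1 : x i = x₀ i := by
        by_contra hc
        have : i ∈ supp R x₀ x := mem_supp.2 ⟨hi, hc⟩
        simp [hx] at this
      have h2 : y i = x₀ i := by
        by_contra hc
        have : i ∈ supp R x₀ y := mem_supp.2 ⟨hi, hc⟩
        simp [hy] at this
      rw [h1, h2])
  rw [hcard] at hm
  have hA0 : (0 : ℝ) < A.card := by exact_mod_cast card_pos.2 hG.neA
  have hB0 : (0 : ℝ) < B.card := by exact_mod_cast card_pos.2 hG.neB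
  have hm' : (∏ i ∈ Rᶜ, (p i : ℝ)) * (∏ i ∈ Rᶜ, (p i : ℝ)) ≤ A.card * B.card := by exact_mod_cast hm
  have hP0 : 0 < ∏ i ∈ Rᶜ, (p i : ℝ) := prod_pos fun i _ => by linarith [hp' i]
  have hl := Real.log_le_log (mul_pos hP0 hP0) hm'
  rw [Real.log_mul hP0.ne' hP0.ne', Real.log_mul hA0.ne' hB0.ne',
    Real.log_prod (fun i _ => by linarith [hp' i])] at hl
  have hsp := sum_compl_add_sum R (fun i => Real.log (p i : ℝ))
  have h1 : ∑ i ∈ T, (1 - 2 / (p i : ℝ)) * Real.log ((p i : ℝ) - 1) ≤ ∑ i ∈ R, Real.log (p i) := by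
    linarith
  have hk4 : (3 : ℝ) ≤ k := by exact_mod_cast hk3
  have hlk : 0 < Real.log (k : ℝ) := Real.log_pos (by linarith)
  have hS : 0 < ∑ i ∈ T, Real.log (p i) :=
    sum_pos (fun i _ => Real.log_pos (by linarith [hp' i])) (card_pos.1 (by omega))
  have h2 : (∑ i ∈ T, Real.log (p i)) * ((1 - 2 / (k : ℝ)) * Real.log ((k : ℝ) - 1)) ≤
      Real.log k * ∑ i ∈ T, (1 - 2 / (p i : ℝ)) * Real.log ((p i : ℝ) - 1) := by
    rw [sum_mul, mul_sum]
    exact sum_le_sum fun i _ => f_ratio hk3 (hk' i)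
  refine le_of_mul_le_mul_left ?_ hS
  have hT0 : (0 : ℝ) ≤ T.card := Nat.cast_nonneg _
  calc _ = (T.card : ℝ) * ((∑ i ∈ T, Real.log (p i)) *
          ((1 - 2 / (k : ℝ)) * Real.log ((k : ℝ) - 1))) := by ring
    _ ≤ T.card * (Real.log k * ∑ i ∈ R, Real.log (p i)) :=
        mul_le_mul_of_nonneg_left (h2.trans (mul_le_mul_of_nonneg_left h1 hlk.le)) hT0
    _ = Real.log k * (T.card * ∑ i ∈ R, Real.log (p i)) := by ring
    _ ≤ Real.log k * (r * ∑ i ∈ T, Real.log (p i)) := mul_le_mul_of_nonneg_left hR hlk.le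
    _ = _ := by ring
end vec5

open scoped Classical in
/-- From the proof of Theorem 7, part 3: let `1 ≤ r ≤ n`, let `p` be a size
vector with `p_i ≥ 3` for all `i` and minimum entry `k`, and let `(A, B)` be a
maximal `r`-cross-intersecting pair. Then the number of coordinates relevant
for `A` or `B` is at most `r·log k / ((1 - 2/k)·log(k - 1))`; consequently, if
moreover `r·log k < (r + 4)·(1 - 2/k)·log(k - 1)`, then `A` and `B` are
Hamming balls in at most `r + 3` coordinates. -/
theorem theorem7_part3 {n : ℕ} (r : ℕ) (hr : 1 ≤ r) (hrn : r ≤ n)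
    (p : Fin n → ℕ) (hp : ∀ i, 3 ≤ p i)
    (k : ℕ) (hk : ∃ i, p i = k) (hk' : ∀ i, k ≤ p i)
    (A B : Finset (∀ i, Fin (p i))) (hAB : MaxPair r A B) :
    ((univ.filter (fun i => Relevant A i ∨ Relevant B i)).card : ℝ) ≤
      r * Real.log k / ((1 - 2 / (k : ℝ)) * Real.log ((k : ℝ) - 1)) ∧
    ((r : ℝ) * Real.log k < (r + 4) * ((1 - 2 / (k : ℝ)) * Real.log ((k : ℝ) - 1)) →
      (∃ (T : Finset (Fin n)) (x₀ : ∀ i, Fin (p i)) (l : ℕ),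
        T.card ≤ r + 3 ∧ A = hBall T x₀ l) ∧
      (∃ (T : Finset (Fin n)) (x₀ : ∀ i, Fin (p i)) (l : ℕ),
        T.card ≤ r + 3 ∧ B = hBall T x₀ l)) := by
  have hk3 : 3 ≤ k := by obtain ⟨i, rfl⟩ := hk; exact hp i
  have hk4 : (3 : ℝ) ≤ k := by exact_mod_cast hk3
  obtain ⟨T, hT⟩ : ∃ T, T = univ.filter (fun i => Relevant A i ∨ Relevant B i) := ⟨_, rfl⟩
  rw [← hT]
  have hT' : ∀ i, i ∈ T ↔ Relevant A i ∨ Relevant B i := fun i => by rw [hT]; simp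
  obtain ⟨hrT, x₀, hG⟩ := good_of_maxPair hp hrn hAB hT'
  have hb := count_bound hp hr hk3 hk' hAB hrT hG
  have hf : 0 < (1 - 2 / (k : ℝ)) * Real.log ((k : ℝ) - 1) := by
    refine mul_pos ?_ (Real.log_pos (by linarith))
    rw [sub_pos, div_lt_one (by linarith)]; linarith
  refine ⟨by rwa [le_div_iff₀ hf], fun hlt => ?_⟩
  have h1 : (T.card : ℝ) < r + 4 := lt_of_mul_lt_mul_right (hb.trans_lt hlt) hf.le
  have h2 : T.card < r + 4 := by exact_mod_cast h1
  obtain ⟨x₁, a, b, hA, hB⟩ := structure_thm hp (by omega) (by omega) hG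
  exact ⟨⟨T, x₁, a, by omega, hA⟩, ⟨T, x₁, b, by omega, hB⟩⟩
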